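/- arXiv:1907.10743 — 2 statements merged into one kernel-verified Lean document; each statement's English description precedes it below -/
import Mathlib

section
/- Let λₙ∈(0,1] with λₙ→0. Let χ, b∈C_c^∞(ℝ³;ℝ), let m̃:ℝ³→ℝ be an even real symbol of order 0, and set A = b·m̃((1/i)∇) (first apply the Fourier multiplier, then multiply by b). Let K⊂ℝ³ be compact with supp χ contained in the interior of K, and let c>0. Let ψₙ, Nₙ, βₙ=(βₙ¹,βₙ²) be C⁴ real functions on ℝ³ and ψ₀, N₀, β₀=(β₀¹,β₀²) smooth, with Nₙ>0, N₀>0 everywhere and Nₙ, N₀ ≥ c on K. Write (e₀)ₙ = ∂_t−βₙⁱ∂_i and (e₀)₀ = ∂_t−β₀ⁱ∂_i. Assume: sup_n λₙ^{−1}(‖ψₙ−ψ₀‖_{L^∞(K)}+‖Nₙ−N₀‖_{L^∞(K)}+‖βₙ−β₀‖_{L^∞(K)}) < ∞; sup_n(‖∂ψₙ‖_{L^∞(K)}+‖∂Nₙ‖_{L^∞(K)}+‖∂βₙ‖_{L^∞(K)}) < ∞; and ‖∂_{x^i}(Nₙ−N₀)‖_{L^∞(K)} → 0 for i=1,2. Then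 there is a subsequence (not relabeled) along which ∫_{ℝ³} ∂_i(χψₙ)·δ^{ij}·[(e₀)ₙNₙ]·A(∂_j(χψₙ)/Nₙ) dx − ∫_{ℝ³} ∂_i(χψₙ)·δ^{ij}·N₀·A([(e₀)ₙNₙ]·∂_j(χψₙ)/Nₙ²) dx − ∫_{ℝ³} ∂_i(χψₙ)·δ^{ij}·[(e₀)₀N₀]·A(∂_j(χψₙ)/N₀) dx + ∫_{ℝ³} ∂_i(χψₙ)·δ^{ij}·N₀·A([(e₀)₀N₀]·∂_j(χψₙ)/N₀²) dx → 0 as n→∞. -/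
open MeasureTheory Real Filter
open scoped ENNReal

noncomputable section

abbrev E3 : Type := Fin 3 → ℝ

/-- Partial derivative in coordinate direction `α` (direction `0` is time, `1`, `2` spatial). -/
noncomputable def pd (α : Fin 3) (f : E3 → ℝ) (x : E3) : ℝ :=
  fderiv ℝ f x (Pi.single α 1)

/-- Iterated partial derivatives along a list of directions. -/
noncomputable def pds : List (Fin 3) → (E3 → ℝ) → E3 → ℝ
  | [], f => f
  | α :: l, f => pd α (pds l f)

/-- The spatial indices `1, 2` of `Fin 3`. -/
def sp : Fin 2 → Fin 3 := ![1, 2]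

/-- The vector field `(e₀) = ∂_t − βⁱ∂_i` applied to `f`. -/
noncomputable def e0 (b : Fin 2 → E3 → ℝ) (f : E3 → ℝ) (x : E3) : ℝ :=
  pd 0 f x - (b 0 x * pd 1 f x + b 1 x * pd 2 f x)

/-- Fourier transform with the normalization `f̂(ξ) = (2π)^{−3/2} ∫ e^{−i x·ξ} f(x) dx`. -/
noncomputable def FT (f : E3 → ℂ) (ξ : E3) : ℂ :=
  (((2 * Real.pi) ^ (-(3 : ℝ) / 2) : ℝ) : ℂ) *
    ∫ x : E3, Complex.exp (-Complex.I * ((∑ α, x α * ξ α : ℝ) : ℂ)) * f x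

/-- The Fourier multiplier `m̃((1/i)∇)`, defined via the inversion formula, so that
`(m̃((1/i)∇)f)^ = m̃ · f̂`. -/
noncomputable def FMul (m : E3 → ℝ) (f : E3 → ℝ) (x : E3) : ℂ :=
  (((2 * Real.pi) ^ (-(3 : ℝ) / 2) : ℝ) : ℂ) *
    ∫ ξ : E3, Complex.exp (Complex.I * ((∑ α, x α * ξ α : ℝ) : ℂ)) * ((m ξ : ℝ) : ℂ)
      * FT (fun y => ((f y : ℝ) : ℂ)) ξ

/-- A symbol of order 0: all derivatives of order `k` decay like `(1+|ξ|)^{−k}`. -/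
def SymbolOrder0 (m : E3 → ℝ) : Prop :=
  ContDiff ℝ (⊤ : ℕ∞) m ∧
  ∀ l : List (Fin 3), ∃ C : ℝ, ∀ ξ, |pds l m ξ| ≤ C * (1 + ‖ξ‖) ^ (-(l.length : ℝ))

section FourierBilinear

open scoped FourierTransform ContDiff SchwartzMap

variable {V : Type*} [NormedAddCommGroup V] [InnerProductSpace ℝ V] [FiniteDimensional ℝ V]
  [MeasurableSpace V] [BorelSpace V]

theorem integral_fourier_mul_eq {f g : V → ℂ} (hf : Integrable f) (hg : Integrable g) :
    ∫ ξ, 𝓕 f ξ * g ξ = ∫ x, f x * 𝓕 g x := by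
  simpa [flip_innerₗ] using! VectorFourier.integral_fourierIntegral_smul_eq_flip
    (μ := volume) (ν := volume) (L := innerₗ V) Real.continuous_fourierChar
    continuous_inner hf hg

theorem continuous_fourier {f : V → ℂ} (hf : Integrable f) : Continuous (𝓕 f) :=
  VectorFourier.fourierIntegral_continuous Real.continuous_fourierChar
    (by exact continuous_inner) hf

theorem norm_fourier_le {f : V → ℂ} (ξ : V) : ‖𝓕 f ξ‖ ≤ ∫ x, ‖f x‖ :=
  VectorFourier.norm_fourierIntegral_le_integral_norm _ _ _ _ _

/-- On `L¹ ∩ L²` the Fourier integral agrees with the `L²` Fourier transform. -/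
theorem fourier_toLp_ae_eq {f : V → ℂ} (hf : Integrable f) (hf2 : MemLp f 2) :
    ((𝓕 (hf2.toLp f) : Lp ℂ 2 (volume : Measure V)) : V → ℂ) =ᵐ[volume] 𝓕 f := by
  refine ae_eq_of_integral_contDiff_smul_eq
    ((Lp.memLp _).locallyIntegrable (by norm_num))
    (continuous_fourier hf).locallyIntegrable fun g hg hgc => ?_
  have hgc' : HasCompactSupport (fun x => (g x : ℂ)) := hgc.comp_left (g := Complex.ofReal) rfl
  set G : 𝓢(V, ℂ) := hgc'.toSchwartzMap (Complex.ofRealCLM.contDiff.comp hg) with hG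
  have hGv : ∀ x, G x = (g x : ℂ) := fun x => rfl
  have h := DFunLike.congr_fun (Lp.fourier_toTemperedDistribution_eq (hf2.toLp f)) G
  rw [TemperedDistribution.fourier_apply, Lp.toTemperedDistribution_apply,
    Lp.toTemperedDistribution_apply] at h
  calc ∫ x, g x • ((𝓕 (hf2.toLp f) : Lp ℂ 2 (volume : Measure V)) : V → ℂ) x
      = ∫ x, G x • ((𝓕 (hf2.toLp f) : Lp ℂ 2 (volume : Measure V)) : V → ℂ) x := by
        simp [hGv]
    _ = ∫ x, (𝓕 G) x • (hf2.toLp f) x := h.symm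
    _ = ∫ x, 𝓕 (G : V → ℂ) x * f x := by
        refine integral_congr_ae ?_
        filter_upwards [hf2.coeFn_toLp] with x hx
        rw [hx, SchwartzMap.fourier_coe]; rfl
    _ = ∫ x, G x * 𝓕 f x := integral_fourier_mul_eq G.integrable hf
    _ = _ := by simp [hGv]

theorem memLp_fourier {f : V → ℂ} (hf : Integrable f) (hf2 : MemLp f 2) :
    MemLp (𝓕 f) 2 :=
  (memLp_congr_ae (fourier_toLp_ae_eq hf hf2)).1 (Lp.memLp _)

theorem integral_norm_sq_fourier {f : V → ℂ} (hf : Integrable f) (hf2 : MemLp f 2) :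
    ∫ ξ, ‖𝓕 f ξ‖ ^ 2 = ∫ x, ‖f x‖ ^ 2 := by
  have key : ∀ u : Lp ℂ 2 (volume : Measure V), ‖u‖ ^ 2 = ∫ x, ‖u x‖ ^ 2 := by
    intro u
    have h := inner_self_eq_norm_sq_to_K (𝕜 := ℂ) u
    rw [L2.inner_def] at h
    have h' : ((∫ x, ‖u x‖ ^ 2 : ℝ) : ℂ) = ((‖u‖ ^ 2 : ℝ) : ℂ) := by
      rw [← integral_complex_ofReal, Complex.ofReal_pow]
      refine Eq.trans (integral_congr_ae (.of_forall fun x => ?_)) h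
      exact (Complex.ofReal_pow _ _).trans (inner_self_eq_norm_sq_to_K (𝕜 := ℂ) (u x)).symm
    exact_mod_cast h'.symm
  calc ∫ ξ, ‖𝓕 f ξ‖ ^ 2
      = ∫ ξ, ‖((𝓕 (hf2.toLp f) : Lp ℂ 2 (volume : Measure V)) : V → ℂ) ξ‖ ^ 2 :=
        integral_congr_ae ((fourier_toLp_ae_eq hf hf2).mono fun x hx => by
          change _ = ‖_‖ ^ 2
          rw [hx])
    _ = ∫ x, ‖hf2.toLp f x‖ ^ 2 := by rw [← key, Lp.norm_fourier_eq, key]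
    _ = ∫ x, ‖f x‖ ^ 2 :=
        integral_congr_ae (hf2.coeFn_toLp.mono fun x hx => by
          change ‖_‖ ^ 2 = _
          rw [hx])

theorem fourier_fderiv_apply {f : V → ℂ} (hf : ContDiff ℝ 1 f) (hfc : HasCompactSupport f)
    (v ξ : V) : 𝓕 (fun x => fderiv ℝ f x v) ξ = 2 * π * Complex.I * (inner ℝ ξ v : ℝ) * 𝓕 f ξ := by
  have hd : Integrable (fderiv ℝ f) :=
    (hf.continuous_fderiv one_ne_zero).integrable_of_hasCompactSupport (hfc.fderiv ℝ)
  have h := Real.fourier_fderiv (hf.continuous.integrable_of_hasCompactSupport hfc)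
    (hf.differentiable one_ne_zero) hd
  rw [← Real.fourier_continuousLinearMap_apply hd, h]
  rw [VectorFourier.fourierSMulRight_apply]
  change (-(2 * π * Complex.I)) • ((-(inner ℝ ξ v : ℝ)) • 𝓕 f ξ) = _
  rw [Complex.real_smul, smul_eq_mul]
  push_cast
  ring

/-- The pairing `∫ f · μ(D) g` written on the Fourier side. -/
def mulForm (μ : V → ℝ) (f g : V → ℂ) : ℂ :=
  ∫ ξ, 𝓕 f (-ξ) * (μ ξ * 𝓕 g ξ)

/-- Continuous compactly supported functions with integrable Fourier transform. -/
structure FourierNice (f : V → ℂ) : Prop where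
  continuous : Continuous f
  hasCompactSupport : HasCompactSupport f
  integrable_fourier : Integrable (𝓕 f)

namespace FourierNice

variable {f g : V → ℂ}

theorem integrable (hf : FourierNice f) : Integrable f :=
  hf.continuous.integrable_of_hasCompactSupport hf.hasCompactSupport

theorem memLp (hf : FourierNice f) : MemLp f 2 :=
  hf.continuous.memLp_of_hasCompactSupport hf.hasCompactSupport

theorem memLp_fourier (hf : FourierNice f) : MemLp (𝓕 f) 2 :=
  _root_.memLp_fourier hf.integrable hf.memLp

theorem continuous_fourier (hf : FourierNice f) : Continuous (𝓕 f) :=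
  _root_.continuous_fourier hf.integrable

theorem fourier_sub (hf : FourierNice f) (hg : FourierNice g) (ξ : V) :
    𝓕 (fun x => f x - g x) ξ = 𝓕 f ξ - 𝓕 g ξ := by
  simp only [Real.fourier_eq, smul_sub]
  exact integral_sub ((Real.fourierIntegral_convergent_iff ξ).2 hf.integrable)
    ((Real.fourierIntegral_convergent_iff ξ).2 hg.integrable)

theorem sub (hf : FourierNice f) (hg : FourierNice g) : FourierNice (fun x => f x - g x) where
  continuous := hf.continuous.sub hg.continuous
  hasCompactSupport := hf.hasCompactSupport.sub hg.hasCompactSupport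
  integrable_fourier := by
    rw [funext (hf.fourier_sub hg)]
    exact hf.integrable_fourier.sub hg.integrable_fourier

end FourierNice

section MulForm

variable {μ : V → ℝ} {M : ℝ} {f g h : V → ℂ}

theorem integrable_mul_fourier (hμ : Continuous μ) (hM : ∀ ξ, |μ ξ| ≤ M) (hg : FourierNice g) :
    Integrable (fun ξ => (μ ξ : ℂ) * 𝓕 g ξ) :=
  hg.integrable_fourier.bdd_mul (c := M) (by fun_prop) (.of_forall fun ξ => by simpa using hM ξ)

theorem integrable_mulForm (hμ : Continuous μ) (hM : ∀ ξ, |μ ξ| ≤ M) (hf : FourierNice f)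
    (hg : FourierNice g) : Integrable (fun ξ => 𝓕 f (-ξ) * (μ ξ * 𝓕 g ξ)) :=
  (integrable_mul_fourier hμ hM hg).bdd_mul
    (hf.continuous_fourier.comp continuous_neg).aestronglyMeasurable
    (.of_forall fun ξ => norm_fourier_le (-ξ))

theorem integral_mul_fourierInv_eq_mulForm (hμ : Continuous μ) (hM : ∀ ξ, |μ ξ| ≤ M)
    (hf : FourierNice f) (hg : FourierNice g) :
    ∫ x, f x * 𝓕⁻ (fun ξ => (μ ξ : ℂ) * 𝓕 g ξ) x = mulForm μ f g := by
  rw [Real.fourierInv_eq_fourier_comp_neg,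
    ← integral_fourier_mul_eq hf.integrable (integrable_mul_fourier hμ hM hg).comp_neg, mulForm,
    ← integral_neg_eq_self]
  simp

theorem mulForm_comm (heven : ∀ ξ, μ (-ξ) = μ ξ) : mulForm μ f g = mulForm μ g f := by
  rw [mulForm, ← integral_neg_eq_self]
  simp only [neg_neg, heven, mulForm]
  congr 1 with ξ
  ring

theorem mulForm_sub_right (hμ : Continuous μ) (hM : ∀ ξ, |μ ξ| ≤ M) (hf : FourierNice f)
    (hg : FourierNice g) (hh : FourierNice h) :
    mulForm μ f (fun x => g x - h x) = mulForm μ f g - mulForm μ f h := by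
  rw [mulForm, mulForm, mulForm, ← integral_sub (integrable_mulForm hμ hM hf hg)
    (integrable_mulForm hμ hM hf hh)]
  congr 1 with ξ
  rw [hg.fourier_sub hh]
  ring

theorem mulForm_sub_left (hμ : Continuous μ) (hM : ∀ ξ, |μ ξ| ≤ M) (hf : FourierNice f)
    (hg : FourierNice g) (hh : FourierNice h) :
    mulForm μ (fun x => f x - g x) h = mulForm μ f h - mulForm μ g h := by
  rw [mulForm, mulForm, mulForm, ← integral_sub (integrable_mulForm hμ hM hf hh)
    (integrable_mulForm hμ hM hg hh)]
  congr 1 with ξ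
  rw [hf.fourier_sub hg]
  ring

theorem norm_mulForm_le (hM : ∀ ξ, |μ ξ| ≤ M) (hf : FourierNice f) (hg : FourierNice g) :
    ‖mulForm μ f g‖ ≤ M * (√(∫ x, ‖f x‖ ^ 2) * √(∫ x, ‖g x‖ ^ 2)) := by
  have hM0 : 0 ≤ M := (abs_nonneg _).trans (hM 0)
  have hf' : MemLp (fun ξ => 𝓕 f (-ξ)) 2 :=
    hf.memLp_fourier.comp_measurePreserving (Measure.measurePreserving_neg volume)
  have h1 := integral_mul_le_Lp_mul_Lq_of_nonneg (μ := (volume : Measure V))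
    (f := fun ξ => ‖𝓕 f (-ξ)‖) (g := fun ξ => ‖𝓕 g ξ‖) (p := 2) (q := 2)
    ⟨by norm_num, by norm_num, by norm_num⟩
    (.of_forall fun _ => norm_nonneg _) (.of_forall fun _ => norm_nonneg _)
    (by simpa using hf'.norm) (by simpa using hg.memLp_fourier.norm)
  simp only [Real.rpow_two, ← Real.sqrt_eq_rpow] at h1
  rw [integral_neg_eq_self (fun ξ => ‖𝓕 f ξ‖ ^ 2), integral_norm_sq_fourier hf.integrable hf.memLp,
    integral_norm_sq_fourier hg.integrable hg.memLp] at h1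
  refine le_trans ?_ (mul_le_mul_of_nonneg_left h1 hM0)
  rw [← integral_const_mul]
  refine norm_integral_le_of_norm_le ((hf'.norm.integrable_mul hg.memLp_fourier.norm).const_mul M)
    (.of_forall fun ξ => ?_)
  rw [norm_mul, norm_mul, Complex.norm_real, Real.norm_eq_abs]
  calc _ = |μ ξ| * (‖𝓕 f (-ξ)‖ * ‖𝓕 g ξ‖) := by ring
    _ ≤ _ := by gcongr; exact hM ξ

/-- The Fourier transform of a product is the convolution of the Fourier transforms. -/
theorem fourier_mul_eq_integral {a : V → ℂ} (ha : FourierNice a) (hf : FourierNice f) (ξ : V) :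
    𝓕 (fun x => a x * f x) ξ = ∫ ζ, 𝓕 a ζ * 𝓕 f (ξ - ζ) := by
  have hinv : ∀ x, a x = 𝓕 (𝓕 a) (-x) := fun x => by
    rw [← Real.fourierInv_eq_fourier_neg,
      ha.continuous.fourierInv_fourier_eq ha.integrable ha.integrable_fourier]
  have hint : Integrable (fun x : V => Real.fourierChar (inner ℝ x ξ) • f (-x)) := by
    simpa using (Real.fourierIntegral_convergent_iff (-ξ)).2 hf.integrable.comp_neg
  calc 𝓕 (fun x => a x * f x) ξ
      = ∫ x, 𝓕 (𝓕 a) x * (Real.fourierChar (inner ℝ x ξ) • f (-x)) := by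
        rw [Real.fourier_eq, ← integral_neg_eq_self]
        congr 1 with x
        rw [hinv (-x), neg_neg, inner_neg_left, neg_neg, mul_smul_comm]
    _ = ∫ ζ, 𝓕 a ζ * 𝓕 (fun x : V => Real.fourierChar (inner ℝ x ξ) • f (-x)) ζ :=
        integral_fourier_mul_eq ha.integrable_fourier hint
    _ = _ := by
        congr 1 with ζ
        congr 1
        rw [Real.fourier_eq, Real.fourier_eq, ← integral_neg_eq_self]
        congr 1 with x
        rw [smul_smul, ← AddChar.map_add_eq_mul]
        congr 2
        · simp only [inner_neg_left, inner_sub_right]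
          ring
        · rw [neg_neg]

theorem mulForm_commutator_eq (hμ : Continuous μ) (hM : ∀ ξ, |μ ξ| ≤ M) {a : V → ℂ}
    (ha : FourierNice a) (hf : FourierNice f) (hg : FourierNice g) :
    mulForm μ (fun x => a x * f x) g - mulForm μ f (fun x => a x * g x) =
      ∫ ζ, 𝓕 a ζ * ∫ ξ, 𝓕 f (-ξ) * (((μ (ξ - ζ) - μ ξ : ℝ) : ℂ) * 𝓕 g (ξ - ζ)) := by
  have hfc := hf.continuous_fourier
  have hgc := hg.continuous_fourier
  have hac := ha.continuous_fourier
  have I1 : Integrable (fun p : V × V => 𝓕 a p.2 * (𝓕 f (-p.1 - p.2) * (μ p.1 * 𝓕 g p.1)))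
      (volume.prod volume) := by
    have h := ((integrable_mul_fourier hμ hM hg).mul_prod ha.integrable_fourier).bdd_mul
      (f := fun p : V × V => 𝓕 f (-p.1 - p.2)) (by fun_prop)
      (.of_forall fun p => norm_fourier_le _)
    exact h.congr (.of_forall fun p => by simp only; ring)
  have I2 : Integrable (fun p : V × V => 𝓕 a p.2 * (𝓕 f (-p.1) * (μ p.1 * 𝓕 g (p.1 - p.2))))
      (volume.prod volume) := by
    have h0 := (ha.integrable_fourier.convolution_integrand (.mul ℂ ℂ) hg.integrable_fourier)
    have h1 := (h0.bdd_mul (c := M) (f := fun p : V × V => (μ p.1 : ℂ)) (by fun_prop)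
      (.of_forall fun p => by simpa using hM p.1)).bdd_mul
      (f := fun p : V × V => 𝓕 f (-p.1)) (by fun_prop)
      (.of_forall fun p => norm_fourier_le _)
    refine h1.congr (.of_forall fun p => ?_)
    simp only [ContinuousLinearMap.mul_apply']
    ring
  have I3 : Integrable (fun p : V × V =>
      𝓕 a p.1 * (𝓕 f (-p.2) * (μ (p.2 - p.1) * 𝓕 g (p.2 - p.1)))) (volume.prod volume) := by
    have h0 := (ha.integrable_fourier.convolution_integrand (.mul ℂ ℂ)
      (integrable_mul_fourier hμ hM hg))
    have h1 := (h0.bdd_mul (f := fun p : V × V => 𝓕 f (-p.1)) (by fun_prop)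
      (.of_forall fun p => norm_fourier_le _)).swap
    refine h1.congr (.of_forall fun p => ?_)
    simp only [ContinuousLinearMap.mul_apply', Function.comp, Prod.fst_swap, Prod.snd_swap]
    ring
  have E1 : mulForm μ (fun x => a x * f x) g =
      ∫ ζ, ∫ ξ, 𝓕 a ζ * (𝓕 f (-ξ) * (μ (ξ - ζ) * 𝓕 g (ξ - ζ))) := by
    calc mulForm μ (fun x => a x * f x) g
        = ∫ ξ, ∫ ζ, 𝓕 a ζ * (𝓕 f (-ξ - ζ) * (μ ξ * 𝓕 g ξ)) := by
          rw [mulForm]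
          congr 1 with ξ
          rw [fourier_mul_eq_integral ha hf, ← integral_mul_const]
          congr 1 with ζ
          ring
      _ = ∫ ζ, ∫ ξ, 𝓕 a ζ * (𝓕 f (-ξ - ζ) * (μ ξ * 𝓕 g ξ)) := integral_integral_swap I1
      _ = _ := by
          congr 1 with ζ
          rw [← integral_sub_right_eq_self _ ζ]
          congr 1 with ξ
          rw [show -(ξ - ζ) - ζ = -ξ by abel]
  have E2 : mulForm μ f (fun x => a x * g x) =
      ∫ ζ, ∫ ξ, 𝓕 a ζ * (𝓕 f (-ξ) * (μ ξ * 𝓕 g (ξ - ζ))) := by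
    rw [← integral_integral_swap I2, mulForm]
    congr 1 with ξ
    rw [fourier_mul_eq_integral ha hg, ← mul_assoc, ← integral_const_mul]
    congr 1 with ζ
    ring
  rw [E1, E2]
  refine (integral_sub I3.integral_prod_left I2.swap.integral_prod_left).symm.trans ?_
  refine integral_congr_ae ?_
  filter_upwards [I3.prod_right_ae, I2.swap.prod_right_ae] with ζ h3 h2
  rw [← integral_const_mul]
  refine (integral_sub h3 h2).symm.trans (integral_congr_ae (.of_forall fun ξ => ?_))
  simp only [Function.comp, Prod.fst_swap, Prod.snd_swap]
  push_cast
  ring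

end MulForm

theorem tendsto_integral_mul_of_tendsto_zero {G W : ℕ → V → ℂ} {δ : V → ℝ} {C D : ℝ}
    (hG : ∀ n, Continuous (G n)) (hGC : ∀ n ξ, ‖G n ξ‖ ≤ C) (hWC : ∀ n ξ, ‖W n ξ‖ ≤ C)
    (hG2 : ∀ n, MemLp (G n) 2) (hW2 : ∀ n, MemLp (W n) 2)
    (hGi : ∀ n, ∫ ξ, ‖G n ξ‖ ^ 2 ≤ C) (hWi : ∀ n, ∫ ξ, ‖W n ξ‖ ^ 2 ≤ C)
    (hG0 : ∀ ξ, Tendsto (fun n => G n ξ) atTop (nhds 0))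
    (hδD : ∀ ξ, |δ ξ| ≤ D) (hδ0 : Tendsto δ (cocompact V) (nhds 0)) :
    Tendsto (fun n => ∫ ξ, G n ξ * (δ ξ * W n ξ)) atTop (nhds 0) := by
  have hC : 0 ≤ C := (norm_nonneg _).trans (hGC 0 0)
  have hD : 0 ≤ D := (abs_nonneg _).trans (hδD 0)
  have hGs : ∀ n, Integrable (fun ξ => ‖G n ξ‖ ^ 2) := fun n =>
    (hG2 n).integrable_norm_pow (by norm_num)
  have hWs : ∀ n, Integrable (fun ξ => ‖W n ξ‖ ^ 2) := fun n =>
    (hW2 n).integrable_norm_pow (by norm_num)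
  rw [Metric.tendsto_atTop]
  intro ε hε
  set η : ℝ := ε / (4 * (C + 1)) with hη
  have hηpos : 0 < η := by positivity
  obtain ⟨S, hS, hSδ⟩ := mem_cocompact.1 ((Metric.tendsto_nhds.1 hδ0) η hηpos)
  have hGS : ∀ n, IntegrableOn (fun ξ => ‖G n ξ‖) S := fun n =>
    (hG n).norm.continuousOn.integrableOn_compact hS
  have hlim : Tendsto (fun n => D * C * ∫ ξ in S, ‖G n ξ‖) atTop (nhds 0) := by
    have h := tendsto_integral_of_dominated_convergence (μ := volume.restrict S)
      (F := fun n ξ => ‖G n ξ‖) (f := fun _ => 0) (fun _ => C)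
      (fun n => (hG n).norm.aestronglyMeasurable)
      (integrableOn_const hS.measure_lt_top.ne)
      (fun n => .of_forall fun ξ => by simpa using hGC n ξ)
      (.of_forall fun ξ => by simpa using (hG0 ξ).norm)
    simpa using h.const_mul (D * C)
  obtain ⟨N, hN⟩ := (Metric.tendsto_atTop.1 hlim) (ε / 2) (by positivity)
  refine ⟨N, fun n hn => ?_⟩
  have hNn := hN n hn
  rw [dist_zero_right, Real.norm_eq_abs] at hNn
  rw [dist_zero_right]
  have hind : Integrable (fun ξ => S.indicator (fun ξ => D * C * ‖G n ξ‖) ξ) :=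
    (integrable_indicator_iff hS.measurableSet).2 ((hGS n).const_mul _)
  have hsum : Integrable (fun ξ => η * (‖G n ξ‖ ^ 2 + ‖W n ξ‖ ^ 2)) :=
    ((hGs n).add (hWs n)).const_mul _
  have hbound : ‖∫ ξ, G n ξ * (δ ξ * W n ξ)‖ ≤
      ∫ ξ, (S.indicator (fun ξ => D * C * ‖G n ξ‖) ξ + η * (‖G n ξ‖ ^ 2 + ‖W n ξ‖ ^ 2)) := by
    refine norm_integral_le_of_norm_le (hind.add hsum) (.of_forall fun ξ => ?_)
    rw [norm_mul, norm_mul, Complex.norm_real, Real.norm_eq_abs]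
    by_cases hξ : ξ ∈ S
    · rw [Set.indicator_of_mem hξ]
      have h1 : ‖G n ξ‖ * (|δ ξ| * ‖W n ξ‖) ≤ ‖G n ξ‖ * (D * C) := by
        gcongr
        exacts [hδD ξ, hWC n ξ]
      have h2 : 0 ≤ η * (‖G n ξ‖ ^ 2 + ‖W n ξ‖ ^ 2) := by positivity
      linarith
    · rw [Set.indicator_of_notMem hξ, zero_add]
      have h1 : |δ ξ| ≤ η := by
        have := hSδ hξ
        rw [Set.mem_ofPred_eq, dist_zero_right, Real.norm_eq_abs] at this
        exact this.le
      calc ‖G n ξ‖ * (|δ ξ| * ‖W n ξ‖) = |δ ξ| * (‖G n ξ‖ * ‖W n ξ‖) := by ring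
        _ ≤ η * (‖G n ξ‖ ^ 2 + ‖W n ξ‖ ^ 2) := by
          gcongr
          nlinarith [sq_nonneg (‖G n ξ‖ - ‖W n ξ‖), sq_nonneg (‖G n ξ‖), sq_nonneg (‖W n ξ‖)]
  rw [integral_add hind hsum, integral_indicator hS.measurableSet, integral_const_mul,
    integral_const_mul, integral_add (hGs n) (hWs n)] at hbound
  have h3 : η * ((∫ ξ, ‖G n ξ‖ ^ 2) + ∫ ξ, ‖W n ξ‖ ^ 2) < ε / 2 := by
    calc η * ((∫ ξ, ‖G n ξ‖ ^ 2) + ∫ ξ, ‖W n ξ‖ ^ 2) ≤ η * (C + C) := by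
          gcongr
          exacts [hGi n, hWi n]
      _ < η * (2 * (C + 1)) := by gcongr; linarith
      _ = ε / 2 := by rw [hη]; field_simp; ring
  have h4 := le_abs_self (D * C * ∫ ξ in S, ‖G n ξ‖)
  linarith

/-- Commutators of a slowly oscillating Fourier multiplier with multiplication operators are
compact: they send bounded, weakly null sequences to null sequences. -/
theorem tendsto_mulForm_commutator {μ : V → ℝ} {M C : ℝ} (hμ : Continuous μ)
    (hM : ∀ ξ, |μ ξ| ≤ M)
    (hdec : ∀ ζ, Tendsto (fun ξ => μ (ξ - ζ) - μ ξ) (cocompact V) (nhds 0))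
    {a : V → ℂ} (ha : FourierNice a) {g v : ℕ → V → ℂ}
    (hg : ∀ n, FourierNice (g n)) (hv : ∀ n, FourierNice (v n))
    (hg1 : ∀ n, ∫ x, ‖g n x‖ ≤ C) (hv1 : ∀ n, ∫ x, ‖v n x‖ ≤ C)
    (hg2 : ∀ n, ∫ x, ‖g n x‖ ^ 2 ≤ C) (hv2 : ∀ n, ∫ x, ‖v n x‖ ^ 2 ≤ C)
    (hg0 : ∀ ξ, Tendsto (fun n => 𝓕 (g n) ξ) atTop (nhds 0)) :
    Tendsto (fun n => mulForm μ (fun x => a x * g n x) (v n)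
      - mulForm μ (g n) (fun x => a x * v n x)) atTop (nhds 0) := by
  simp only [fun n => mulForm_commutator_eq hμ hM ha (hg n) (hv n)]
  have hM0 : 0 ≤ M := (abs_nonneg _).trans (hM 0)
  have hD : ∀ ξ ζ, |μ (ξ - ζ) - μ ξ| ≤ 2 * M := fun ξ ζ =>
    (abs_sub _ _).trans (by linarith [hM (ξ - ζ), hM ξ])
  have hG2 : ∀ n, MemLp (fun ξ => 𝓕 (g n) (-ξ)) 2 := fun n =>
    (hg n).memLp_fourier.comp_measurePreserving (Measure.measurePreserving_neg volume)
  have hW2 : ∀ ζ n, MemLp (fun ξ => 𝓕 (v n) (ξ - ζ)) 2 := fun ζ n =>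
    (hv n).memLp_fourier.comp_measurePreserving (measurePreserving_sub_right volume ζ)
  have hGi : ∀ n, ∫ ξ, ‖𝓕 (g n) (-ξ)‖ ^ 2 ≤ C := fun n => by
    rw [integral_neg_eq_self (fun ξ => ‖𝓕 (g n) ξ‖ ^ 2),
      integral_norm_sq_fourier (hg n).integrable (hg n).memLp]
    exact hg2 n
  have hWi : ∀ ζ n, ∫ ξ, ‖𝓕 (v n) (ξ - ζ)‖ ^ 2 ≤ C := fun ζ n => by
    rw [integral_sub_right_eq_self (fun ξ => ‖𝓕 (v n) ξ‖ ^ 2),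
      integral_norm_sq_fourier (hv n).integrable (hv n).memLp]
    exact hv2 n
  have hinner : ∀ ζ, Tendsto (fun n => ∫ ξ, 𝓕 (g n) (-ξ) *
      (((μ (ξ - ζ) - μ ξ : ℝ) : ℂ) * 𝓕 (v n) (ξ - ζ))) atTop (nhds 0) := fun ζ =>
    tendsto_integral_mul_of_tendsto_zero (C := C) (δ := fun ξ => μ (ξ - ζ) - μ ξ)
      (fun n => (hg n).continuous_fourier.comp continuous_neg)
      (fun n ξ => (norm_fourier_le _).trans (hg1 n)) (fun n ξ => (norm_fourier_le _).trans (hv1 n))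
      hG2 (hW2 ζ) hGi (hWi ζ) (fun ξ => hg0 (-ξ)) (fun ξ => hD ξ ζ) (hdec ζ)
  have hmeas : ∀ n, AEStronglyMeasurable (fun ζ => 𝓕 a ζ * ∫ ξ, 𝓕 (g n) (-ξ) *
      (((μ (ξ - ζ) - μ ξ : ℝ) : ℂ) * 𝓕 (v n) (ξ - ζ))) := fun n => by
    refine ha.continuous_fourier.aestronglyMeasurable.mul ?_
    have hgc := (hg n).continuous_fourier
    have hvc := (hv n).continuous_fourier
    have : AEStronglyMeasurable (fun p : V × V => 𝓕 (g n) (-p.2) *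
      (((μ (p.2 - p.1) - μ p.2 : ℝ) : ℂ) * 𝓕 (v n) (p.2 - p.1))) (volume.prod volume) := by
      refine Continuous.aestronglyMeasurable ?_
      fun_prop
    exact this.integral_prod_right'
  have hbound : ∀ n ζ, ‖𝓕 a ζ * ∫ ξ, 𝓕 (g n) (-ξ) *
      (((μ (ξ - ζ) - μ ξ : ℝ) : ℂ) * 𝓕 (v n) (ξ - ζ))‖ ≤ ‖𝓕 a ζ‖ * (2 * M * (C + C)) := by
    intro n ζ
    have hGs := (hG2 n).integrable_norm_pow (p := 2) (by norm_num)
    have hWs := (hW2 ζ n).integrable_norm_pow (p := 2) (by norm_num)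
    rw [norm_mul]
    gcongr
    refine (norm_integral_le_of_norm_le ((hGs.add hWs).const_mul (2 * M))
      (.of_forall fun ξ => ?_)).trans ?_
    · rw [norm_mul, norm_mul, Complex.norm_real, Real.norm_eq_abs]
      calc ‖𝓕 (g n) (-ξ)‖ * (|μ (ξ - ζ) - μ ξ| * ‖𝓕 (v n) (ξ - ζ)‖)
          = |μ (ξ - ζ) - μ ξ| * (‖𝓕 (g n) (-ξ)‖ * ‖𝓕 (v n) (ξ - ζ)‖) := by ring
        _ ≤ 2 * M * (‖𝓕 (g n) (-ξ)‖ ^ 2 + ‖𝓕 (v n) (ξ - ζ)‖ ^ 2) := by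
          gcongr
          · exact hD ξ ζ
          · nlinarith [sq_nonneg (‖𝓕 (g n) (-ξ)‖ - ‖𝓕 (v n) (ξ - ζ)‖),
              sq_nonneg (‖𝓕 (g n) (-ξ)‖), sq_nonneg (‖𝓕 (v n) (ξ - ζ)‖)]
    · rw [integral_const_mul]
      refine mul_le_mul_of_nonneg_left ?_ (by positivity)
      refine (integral_add hGs hWs).trans_le ?_
      exact add_le_add (hGi n) (hWi ζ n)
  simpa using tendsto_integral_of_dominated_convergence (f := fun _ => (0 : ℂ))
    (fun ζ => ‖𝓕 a ζ‖ * (2 * M * (C + C))) hmeas (ha.integrable_fourier.norm.mul_const _)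
    (fun n => .of_forall (hbound n))
    (.of_forall fun ζ => by simpa using (hinner ζ).const_mul (𝓕 a ζ))

/-- In dimension at most three, `C²` functions of compact support have integrable Fourier
transform. -/
theorem fourierNice_of_contDiff (hV : Module.finrank ℝ V < 4) {f : V → ℂ} (hf : ContDiff ℝ 2 f)
    (hfc : HasCompactSupport f) : FourierNice f := by
  refine ⟨hf.continuous, hfc, ?_⟩
  have hfi := hf.continuous.integrable_of_hasCompactSupport hfc (μ := volume)
  have hf2 := memLp_fourier hfi (hf.continuous.memLp_of_hasCompactSupport hfc)
  let e := stdOrthonormalBasis ℝ V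
  have hd : ∀ v, ContDiff ℝ 1 (fun x => fderiv ℝ f x v) := fun v =>
    (hf.fderiv_right (m := 1) (by norm_num)).clm_apply contDiff_const
  have hdc : ∀ v, HasCompactSupport (fun x => fderiv ℝ f x v) := fun v =>
    hfc.fderiv_apply ℝ v
  have hdd : ∀ v, MemLp (𝓕 (fun x => fderiv ℝ (fun y => fderiv ℝ f y v) x v)) 2 := fun v => by
    have hc : Continuous (fun x => fderiv ℝ (fun y => fderiv ℝ f y v) x v) :=
      ((hd v).continuous_fderiv one_ne_zero).clm_apply continuous_const
    have hs : HasCompactSupport (fun x => fderiv ℝ (fun y => fderiv ℝ f y v) x v) :=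
      (hdc v).fderiv_apply ℝ v
    exact memLp_fourier (hc.integrable_of_hasCompactSupport hs) (hc.memLp_of_hasCompactSupport hs)
  have hsum : ∀ ξ, ((‖ξ‖ ^ 2 : ℝ) : ℂ) * 𝓕 f ξ = ∑ i,
      (-(1 / (2 * π) ^ 2 : ℂ)) • 𝓕 (fun x => fderiv ℝ (fun y => fderiv ℝ f y (e i)) x (e i)) ξ := by
    intro ξ
    rw [← e.sum_sq_norm_inner_left ξ]
    push_cast
    rw [Finset.sum_mul]
    refine Finset.sum_congr rfl fun i _ => ?_
    rw [fourier_fderiv_apply (hd _) (hdc _), fourier_fderiv_apply (hf.of_le (by norm_num)) hfc]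
    have : ((‖(inner ℝ ξ (e i) : ℝ)‖ : ℝ) : ℂ) ^ 2 = ((inner ℝ ξ (e i) : ℝ) : ℂ) ^ 2 := by
      rw [← Complex.ofReal_pow, Real.norm_eq_abs, sq_abs, Complex.ofReal_pow]
    rw [this, smul_eq_mul]
    have hpi : (π : ℂ) ≠ 0 := by exact_mod_cast Real.pi_ne_zero
    field_simp
    linear_combination ((inner ℝ ξ (e i) : ℝ) : ℂ) ^ 2 * 𝓕 f ξ * Complex.I_sq
  have h2 : MemLp (fun ξ => ((1 + ‖ξ‖ ^ 2 : ℝ) : ℂ) * 𝓕 f ξ) 2 := by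
    have : MemLp (fun ξ => ∑ i, (-(1 / (2 * π) ^ 2 : ℂ)) •
        𝓕 (fun x => fderiv ℝ (fun y => fderiv ℝ f y (e i)) x (e i)) ξ) 2 :=
      memLp_finsetSum _ fun i _ => (hdd (e i)).const_smul (-(1 / (2 * π) ^ 2 : ℂ))
    refine (hf2.add this).ae_eq (.of_forall fun ξ => ?_)
    simp only [Pi.add_apply, ← hsum]
    push_cast
    ring
  have h1 : MemLp (fun ξ : V => (((1 + ‖ξ‖ ^ 2)⁻¹ : ℝ) : ℂ)) 2 := by
    have hpos : ∀ ξ : V, 0 < 1 + ‖ξ‖ ^ 2 := fun ξ => by positivity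
    refine (memLp_two_iff_integrable_sq_norm ?_).2 ?_
    · refine Continuous.aestronglyMeasurable ?_
      exact Complex.continuous_ofReal.comp
        ((by fun_prop : Continuous fun ξ : V => 1 + ‖ξ‖ ^ 2).inv₀ fun ξ => (hpos ξ).ne')
    · refine (integrable_rpow_neg_one_add_norm_sq (μ := volume) (E := V) (r := 4)
        (by exact_mod_cast hV)).congr (.of_forall fun ξ => ?_)
      simp only [Complex.norm_real, Real.norm_eq_abs, sq_abs]
      rw [show (-4 / 2 : ℝ) = -(2 : ℕ) by norm_num, Real.rpow_neg (hpos ξ).le, Real.rpow_natCast,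
        inv_pow]
  refine (h1.integrable_mul h2).congr (.of_forall fun ξ => ?_)
  have hpos : ((1 + ‖ξ‖ ^ 2 : ℝ) : ℂ) ≠ 0 := by
    exact_mod_cast (by positivity : (1 + ‖ξ‖ ^ 2 : ℝ) ≠ 0)
  simp only [Pi.mul_apply]
  rw [← mul_assoc, Complex.ofReal_inv, inv_mul_cancel₀ hpos, one_mul]

end FourierBilinear

section Transfer

open scoped FourierTransform ContDiff

/-- A real function on `E3` viewed as a complex function on Euclidean space. -/
def lift (f : E3 → ℝ) (v : EuclideanSpace ℝ (Fin 3)) : ℂ := (f v.ofLp : ℂ)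

/-- The rescaled symbol on Euclidean space. -/
def liftSymbol (m : E3 → ℝ) (v : EuclideanSpace ℝ (Fin 3)) : ℝ := m ((2 * π) • v.ofLp)

theorem integral_comp_ofLp {F : Type*} [NormedAddCommGroup F] [NormedSpace ℝ F] (f : E3 → F) :
    ∫ v : EuclideanSpace ℝ (Fin 3), f v.ofLp = ∫ x, f x :=
  (PiLp.volume_preserving_ofLp (Fin 3)).integral_comp
    (MeasurableEquiv.toLp 2 (Fin 3 → ℝ)).symm.measurableEmbedding f

theorem lift_fourierNice {f : E3 → ℝ} (hf : ContDiff ℝ 2 f) (hfc : HasCompactSupport f) :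
    FourierNice (lift f) := by
  refine fourierNice_of_contDiff (by simp) ?_ ?_
  · exact Complex.ofRealCLM.contDiff.comp
      (hf.comp (EuclideanSpace.equiv (Fin 3) ℝ).contDiff)
  · exact (hfc.comp_homeomorph
      (EuclideanSpace.equiv (Fin 3) ℝ).toHomeomorph).comp_left (g := Complex.ofReal) rfl

theorem FT_eq_fourier (f : E3 → ℝ) (η : EuclideanSpace ℝ (Fin 3)) :
    FT (fun y => (f y : ℂ)) ((2 * π) • η.ofLp) =
      (((2 * π) ^ (-(3 : ℝ) / 2) : ℝ) : ℂ) * 𝓕 (lift f) η := by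
  rw [FT, Real.fourier_eq', ← integral_comp_ofLp]
  congr 2 with v
  rw [smul_eq_mul, lift]
  congr 2
  simp only [PiLp.inner_apply, Pi.smul_apply, smul_eq_mul, RCLike.inner_apply, conj_trivial]
  push_cast
  simp only [Finset.mul_sum, Finset.sum_mul]
  refine Finset.sum_congr rfl fun i _ => ?_
  ring

theorem FMul_eq_fourierInv (m f : E3 → ℝ) (v : EuclideanSpace ℝ (Fin 3)) :
    FMul m f v.ofLp = 𝓕⁻ (fun η => (liftSymbol m η : ℂ) * 𝓕 (lift f) η) v := by
  have hc : (((2 * π) ^ (-(3 : ℝ) / 2) : ℝ) : ℂ) * (((2 * π) ^ 3 : ℝ) : ℂ) *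
      (((2 * π) ^ (-(3 : ℝ) / 2) : ℝ) : ℂ) = 1 := by
    rw [← Complex.ofReal_mul, ← Complex.ofReal_mul, ← Real.rpow_natCast,
      ← Real.rpow_add (by positivity), ← Real.rpow_add (by positivity)]
    norm_num
  have hs := Measure.integral_comp_smul (volume : Measure E3) (fun ξ : E3 =>
    Complex.exp (Complex.I * ((∑ α, v.ofLp α * ξ α : ℝ) : ℂ)) * ((m ξ : ℝ) : ℂ)
      * FT (fun y => ((f y : ℝ) : ℂ)) ξ) (2 * π)
  have hs' : ∫ ξ : E3, Complex.exp (Complex.I * ((∑ α, v.ofLp α * ξ α : ℝ) : ℂ)) * ((m ξ : ℝ) : ℂ)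
      * FT (fun y => ((f y : ℝ) : ℂ)) ξ = (((2 * π) ^ 3 : ℝ) : ℂ) * ∫ η : E3,
      Complex.exp (Complex.I * ((∑ α, v.ofLp α * ((2 * π) • η) α : ℝ) : ℂ)) *
        ((m ((2 * π) • η) : ℝ) : ℂ) * FT (fun y => ((f y : ℝ) : ℂ)) ((2 * π) • η) := by
    rw [hs, Module.finrank_fintype_fun_eq_card, Fintype.card_fin, abs_of_pos (by positivity),
      Complex.real_smul, ← mul_assoc, ← Complex.ofReal_mul, mul_inv_cancel₀ (by positivity),
      Complex.ofReal_one, one_mul]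
  rw [FMul, hs', ← integral_comp_ofLp, Real.fourierInv_eq']
  simp only [FT_eq_fourier]
  rw [← mul_assoc, ← integral_const_mul]
  congr 1 with η
  rw [smul_eq_mul, liftSymbol]
  have he : Complex.I * ((∑ α, v.ofLp α * ((2 * π) • η.ofLp) α : ℝ) : ℂ) =
      ((2 * π * inner ℝ η v : ℝ) : ℂ) * Complex.I := by
    simp only [PiLp.inner_apply, Pi.smul_apply, smul_eq_mul, RCLike.inner_apply, conj_trivial]
    push_cast
    simp only [Finset.mul_sum, Finset.sum_mul]
    refine Finset.sum_congr rfl fun i _ => ?_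
    ring
  rw [he]
  linear_combination (Complex.exp (((2 * π * inner ℝ η v : ℝ) : ℂ) * Complex.I) *
    ((m ((2 * π) • η.ofLp) : ℝ) : ℂ) * 𝓕 (lift f) η) * hc

variable {m : E3 → ℝ}

theorem integrable_mul_FMul {M : ℝ} (hμ : Continuous (liftSymbol m))
    (hM : ∀ ξ, |liftSymbol m ξ| ≤ M) {f g : E3 → ℝ} (hf : Continuous f)
    (hfc : HasCompactSupport f) (hg : ContDiff ℝ 2 g) (hgc : HasCompactSupport g) :
    Integrable (fun x => (f x : ℂ) * FMul m g x) := by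
  have h1 := integrable_mul_fourier hμ hM (lift_fourierNice hg hgc)
  have hc : Continuous (fun x => FMul m g x) := by
    have : (fun x => FMul m g x) = fun x =>
        𝓕⁻ (fun η => (liftSymbol m η : ℂ) * 𝓕 (lift g) η) (WithLp.toLp 2 x) :=
      funext fun x => FMul_eq_fourierInv m g (WithLp.toLp 2 x)
    rw [this, Real.fourierInv_eq_fourier_comp_neg]
    exact (continuous_fourier h1.comp_neg).comp (PiLp.continuous_toLp 2 _)
  refine Continuous.integrable_of_hasCompactSupport
    ((Complex.continuous_ofReal.comp hf).mul hc) ?_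
  exact (hfc.comp_left (g := Complex.ofReal) rfl).mul_right

theorem integral_sum_mul_FMul {M : ℝ} (hμ : Continuous (liftSymbol m))
    (hM : ∀ ξ, |liftSymbol m ξ| ≤ M) {ι : Type*} [Fintype ι] {f g : ι → E3 → ℝ}
    (hf : ∀ i, ContDiff ℝ 2 (f i)) (hfc : ∀ i, HasCompactSupport (f i))
    (hg : ∀ i, ContDiff ℝ 2 (g i)) (hgc : ∀ i, HasCompactSupport (g i)) :
    ∫ x, ∑ i, (f i x : ℂ) * FMul m (g i) x =
      ∑ i, mulForm (liftSymbol m) (lift (f i)) (lift (g i)) := by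
  rw [integral_finsetSum _ fun i _ =>
    integrable_mul_FMul hμ hM (hf i).continuous (hfc i) (hg i) (hgc i)]
  refine Finset.sum_congr rfl fun i _ => ?_
  rw [← integral_comp_ofLp, ← integral_mul_fourierInv_eq_mulForm hμ hM
    (lift_fourierNice (hf i) (hfc i)) (lift_fourierNice (hg i) (hgc i))]
  simp only [FMul_eq_fourierInv, lift]

theorem norm_fderiv_le_sum_pd (f : E3 → ℝ) (x : E3) : ‖fderiv ℝ f x‖ ≤ ∑ α, |pd α f x| := by
  refine ContinuousLinearMap.opNorm_le_bound _ (by positivity) fun y => ?_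
  have hy : fderiv ℝ f x y = ∑ α, y α * pd α f x := by
    conv_lhs => rw [pi_eq_sum_univ' y]
    rw [map_sum]
    refine Finset.sum_congr rfl fun α _ => ?_
    rw [map_smul, smul_eq_mul, pd]
  rw [hy, Finset.sum_mul]
  refine (norm_sum_le _ _).trans (Finset.sum_le_sum fun α _ => ?_)
  rw [norm_mul, mul_comm, Real.norm_eq_abs (pd α f x)]
  gcongr
  exact norm_le_pi_norm y α

theorem SymbolOrder0.exists_bound (hm : SymbolOrder0 m) : ∃ M, ∀ ξ, |liftSymbol m ξ| ≤ M := by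
  obtain ⟨C, hC⟩ := hm.2 []
  refine ⟨C, fun ξ => ?_⟩
  simpa [pds, liftSymbol] using hC ((2 * π) • ξ.ofLp)

theorem SymbolOrder0.continuous_liftSymbol (hm : SymbolOrder0 m) : Continuous (liftSymbol m) :=
  hm.1.continuous.comp
    (by fun_prop : Continuous fun v : EuclideanSpace ℝ (Fin 3) => (2 * π) • v.ofLp)

/-- Symbols of order zero are slowly oscillating at infinity. -/
theorem SymbolOrder0.tendsto_sub (hm : SymbolOrder0 m) (ζ : E3) :
    Tendsto (fun ξ => m (ξ - ζ) - m ξ) (cocompact E3) (nhds 0) := by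
  have hd : ∃ C : ℝ, 0 ≤ C ∧ ∀ ξ, ‖fderiv ℝ m ξ‖ ≤ C * (1 + ‖ξ‖)⁻¹ := by
    choose C hC using fun α => hm.2 [α]
    have hle : ∀ ξ, ‖fderiv ℝ m ξ‖ ≤ (∑ α, C α) * (1 + ‖ξ‖)⁻¹ := fun ξ => by
      refine (norm_fderiv_le_sum_pd m ξ).trans ?_
      rw [Finset.sum_mul]
      refine Finset.sum_le_sum fun α _ => ?_
      simpa [pds, Real.rpow_neg_one] using hC α ξ
    refine ⟨_, ?_, hle⟩
    simpa using (norm_nonneg _).trans (hle 0)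
  obtain ⟨C, hC0, hC⟩ := hd
  have hlim : Tendsto (fun ξ : E3 => C * (1 + (‖ξ‖ - ‖ζ‖))⁻¹ * ‖ζ‖) (cocompact E3) (nhds 0) := by
    have h1 : Tendsto (fun ξ : E3 => 1 + (‖ξ‖ - ‖ζ‖)) (cocompact E3) atTop :=
      tendsto_atTop_add_const_left _ _
        (tendsto_atTop_add_const_right _ _ (tendsto_norm_cocompact_atTop))
    simpa using (h1.inv_tendsto_atTop.const_mul C).mul_const ‖ζ‖
  refine squeeze_zero_norm' ?_ hlim
  filter_upwards [tendsto_norm_cocompact_atTop.eventually_ge_atTop ‖ζ‖] with ξ hξ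
  have h := Convex.norm_image_sub_le_of_norm_fderiv_le (𝕜 := ℝ) (f := m)
    (s := Metric.closedBall ξ ‖ζ‖) (C := C * (1 + (‖ξ‖ - ‖ζ‖))⁻¹) (x := ξ) (y := ξ - ζ)
    (fun x _ => (hm.1.differentiable (by simp)) x) (fun x hx => ?_) (convex_closedBall _ _)
    (Metric.mem_closedBall_self (norm_nonneg _)) (by simp)
  · simpa using h
  · refine (hC x).trans ?_
    have : ‖ξ‖ - ‖ζ‖ ≤ ‖x‖ := by
      have h1 := norm_sub_norm_le ξ x
      rw [mem_closedBall_iff_norm, norm_sub_rev] at hx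
      linarith
    gcongr

theorem SymbolOrder0.tendsto_liftSymbol_sub (hm : SymbolOrder0 m)
    (ζ : EuclideanSpace ℝ (Fin 3)) :
    Tendsto (fun ξ => liftSymbol m (ξ - ζ) - liftSymbol m ξ) (cocompact _) (nhds 0) := by
  have hpi : (2 * π) ≠ 0 := by positivity
  have hc : Tendsto (fun ξ : EuclideanSpace ℝ (Fin 3) => (2 * π) • ξ.ofLp) (cocompact _)
      (cocompact E3) :=
    ((EuclideanSpace.equiv (Fin 3) ℝ).toHomeomorph.trans
      (Homeomorph.smulOfNeZero (2 * π) hpi)).isClosedEmbedding.tendsto_cocompact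
  refine ((hm.tendsto_sub ((2 * π) • ζ.ofLp)).comp hc).congr fun ξ => ?_
  simp [liftSymbol, smul_sub]

end Transfer

section UniformBounds

/-- Uniform boundedness of a sequence of functions on a set. -/
def UBdd (K : Set E3) (f : ℕ → E3 → ℝ) : Prop := ∃ C, ∀ n, ∀ x ∈ K, |f n x| ≤ C

/-- Uniform convergence to zero of a sequence of functions on a set. -/
def USmall (K : Set E3) (f : ℕ → E3 → ℝ) : Prop :=
  ∀ ε > 0, ∀ᶠ n in atTop, ∀ x ∈ K, |f n x| ≤ ε

variable {K : Set E3} {f g : ℕ → E3 → ℝ}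

theorem UBdd.exists_nonneg (hf : UBdd K f) : ∃ C, 0 ≤ C ∧ ∀ n, ∀ x ∈ K, |f n x| ≤ C := by
  obtain ⟨C, hC⟩ := hf
  exact ⟨max C 0, le_max_right _ _, fun n x hx => (hC n x hx).trans (le_max_left _ _)⟩

theorem UBdd.of_continuous (hK : IsCompact K) {f : E3 → ℝ} (hf : Continuous f) :
    UBdd K (fun _ => f) := by
  obtain ⟨C, hC⟩ := hK.exists_bound_of_continuousOn hf.continuousOn
  exact ⟨C, fun _ x hx => hC x hx⟩

theorem UBdd.add (hf : UBdd K f) (hg : UBdd K g) : UBdd K (fun n x => f n x + g n x) := by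
  obtain ⟨C, hC⟩ := hf
  obtain ⟨D, hD⟩ := hg
  exact ⟨C + D, fun n x hx => (abs_add_le _ _).trans <| add_le_add (hC n x hx) (hD n x hx)⟩

theorem UBdd.sub (hf : UBdd K f) (hg : UBdd K g) : UBdd K (fun n x => f n x - g n x) := by
  obtain ⟨C, hC⟩ := hf
  obtain ⟨D, hD⟩ := hg
  exact ⟨C + D, fun n x hx => (abs_sub _ _).trans <| add_le_add (hC n x hx) (hD n x hx)⟩

theorem UBdd.mul (hf : UBdd K f) (hg : UBdd K g) : UBdd K (fun n x => f n x * g n x) := by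
  obtain ⟨C, hC0, hC⟩ := hf.exists_nonneg
  obtain ⟨D, hD⟩ := hg
  refine ⟨C * D, fun n x hx => ?_⟩
  rw [abs_mul]
  exact mul_le_mul (hC n x hx) (hD n x hx) (abs_nonneg _) hC0

theorem UBdd.inv_of_le {c : ℝ} (hc : 0 < c) (hf : ∀ n, ∀ x ∈ K, c ≤ f n x) :
    UBdd K (fun n x => (f n x)⁻¹) := by
  refine ⟨c⁻¹, fun n x hx => ?_⟩
  rw [abs_of_nonneg (inv_nonneg.2 (hc.le.trans (hf n x hx)))]
  exact inv_anti₀ hc (hf n x hx)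

theorem USmall.of_le {C : ℝ} {l : ℕ → ℝ} (hl : Tendsto l atTop (nhds 0))
    (hf : ∀ n, ∀ x ∈ K, |f n x| ≤ C * l n) : USmall K f := fun ε hε => by
  have h : Tendsto (fun n => C * l n) atTop (nhds 0) := by simpa using hl.const_mul C
  filter_upwards [h.eventually_le_const hε] with n hn x hx
  exact (hf n x hx).trans hn

theorem USmall.of_tendstoUniformlyOn (hf : TendstoUniformlyOn f 0 atTop K) : USmall K f :=
  fun ε hε => by
  filter_upwards [Metric.tendstoUniformlyOn_iff.1 hf ε hε] with n hn x hx
  have := hn x hx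
  rw [Pi.zero_apply, dist_zero_left] at this
  exact this.le

theorem USmall.add (hf : USmall K f) (hg : USmall K g) :
    USmall K (fun n x => f n x + g n x) := fun ε hε => by
  filter_upwards [hf (ε / 2) (half_pos hε), hg (ε / 2) (half_pos hε)] with n h1 h2 x hx
  linarith [abs_add_le (f n x) (g n x), h1 x hx, h2 x hx]

theorem USmall.mul_uBdd (hf : USmall K f) (hg : UBdd K g) :
    USmall K (fun n x => f n x * g n x) := fun ε hε => by
  obtain ⟨C, hC0, hC⟩ := hg.exists_nonneg
  have hC1 : 0 < C + 1 := by linarith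
  filter_upwards [hf (ε / (C + 1)) (by positivity)] with n h x hx
  rw [abs_mul]
  calc |f n x| * |g n x| ≤ ε / (C + 1) * (C + 1) :=
        mul_le_mul (h x hx) ((hC n x hx).trans (by linarith)) (abs_nonneg _) (by positivity)
    _ = ε := by field_simp

theorem UBdd.mul_uSmall (hf : UBdd K f) (hg : USmall K g) :
    USmall K (fun n x => f n x * g n x) := by
  simpa only [mul_comm] using hg.mul_uBdd hf

theorem USmall.congr (hf : USmall K f) (h : ∀ n, ∀ x ∈ K, g n x = f n x) : USmall K g :=
  fun ε hε => by
  filter_upwards [hf ε hε] with n hn x hx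
  rw [h n x hx]
  exact hn x hx

theorem norm_integral_le_of_zero_off {F : Type*} [NormedAddCommGroup F] [NormedSpace ℝ F]
    (hK : IsCompact K) {f : E3 → F} {C : ℝ} (hf : ∀ x ∈ K, ‖f x‖ ≤ C) (h0 : ∀ x ∉ K, f x = 0) :
    ‖∫ x, f x‖ ≤ C * volume.real K := by
  rw [← setIntegral_eq_integral_of_forall_compl_eq_zero h0]
  exact norm_setIntegral_le_of_norm_le_const hK.measure_lt_top hf

theorem USmall.tendsto_integral (hK : IsCompact K) (hf : USmall K f)
    (h0 : ∀ n, ∀ x ∉ K, f n x = 0) : Tendsto (fun n => ∫ x, f n x) atTop (nhds 0) := by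
  rw [Metric.tendsto_nhds]
  intro ε hε
  have hV : 0 < volume.real K + 1 := by positivity
  filter_upwards [hf (ε / (volume.real K + 1)) (by positivity)] with n hn
  rw [dist_zero_right]
  refine (norm_integral_le_of_zero_off hK hn (h0 n)).trans_lt ?_
  rw [div_mul_eq_mul_div, div_lt_iff₀ hV]
  nlinarith

theorem integral_norm_lift_le (hK : IsCompact K) {f : E3 → ℝ} {C : ℝ}
    (hf : ∀ x ∈ K, |f x| ≤ C) (h0 : ∀ x ∉ K, f x = 0) :
    ∫ v, ‖lift f v‖ ≤ C * volume.real K := by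
  simp only [lift, Complex.norm_real]
  rw [integral_comp_ofLp (fun x => ‖f x‖)]
  refine (Real.le_norm_self _).trans
    (norm_integral_le_of_zero_off hK (fun x hx => ?_) fun x hx => ?_)
  · simpa using hf x hx
  · simp [h0 x hx]

theorem integral_norm_sq_lift_le (hK : IsCompact K) {f : E3 → ℝ} {C : ℝ}
    (hf : ∀ x ∈ K, |f x| ≤ C) (h0 : ∀ x ∉ K, f x = 0) :
    ∫ v, ‖lift f v‖ ^ 2 ≤ C ^ 2 * volume.real K := by
  simp only [lift, Complex.norm_real]
  rw [integral_comp_ofLp (fun x => ‖f x‖ ^ 2)]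
  refine (Real.le_norm_self _).trans
    (norm_integral_le_of_zero_off hK (fun x hx => ?_) fun x hx => ?_)
  · rw [norm_pow, norm_norm]
    exact pow_le_pow_left₀ (norm_nonneg _) (hf x hx) 2
  · simp [h0 x hx]

/-- The bilinear form of a Fourier multiplier tends to zero when one argument is bounded and the
other one is uniformly small. -/
theorem tendsto_mulForm_lift {μ : EuclideanSpace ℝ (Fin 3) → ℝ} {M : ℝ} (hM : ∀ ξ, |μ ξ| ≤ M)
    (hK : IsCompact K) (hf : UBdd K f) (hg : USmall K g)
    (hfn : ∀ n, FourierNice (lift (f n))) (hgn : ∀ n, FourierNice (lift (g n)))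
    (hf0 : ∀ n, ∀ x ∉ K, f n x = 0) (hg0 : ∀ n, ∀ x ∉ K, g n x = 0) :
    Tendsto (fun n => mulForm μ (lift (f n)) (lift (g n))) atTop (nhds 0) := by
  obtain ⟨C, hC0, hC⟩ := hf.exists_nonneg
  have hM0 : 0 ≤ M := (abs_nonneg _).trans (hM 0)
  set D := M * (C * volume.real K) with hD
  have hD0 : 0 ≤ D := by positivity
  rw [Metric.tendsto_nhds]
  intro ε hε
  filter_upwards [hg (ε / (D + 1)) (by positivity)] with n hn
  rw [dist_zero_right]
  refine (norm_mulForm_le hM (hfn n) (hgn n)).trans_lt ?_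
  have h1 := integral_norm_sq_lift_le hK (hC n) (hf0 n)
  have h2 := integral_norm_sq_lift_le hK hn (hg0 n)
  calc M * (√(∫ x, ‖lift (f n) x‖ ^ 2) * √(∫ x, ‖lift (g n) x‖ ^ 2))
      ≤ M * (√(C ^ 2 * volume.real K) * √((ε / (D + 1)) ^ 2 * volume.real K)) := by gcongr
    _ = D * (ε / (D + 1)) := by
      rw [Real.sqrt_mul (by positivity), Real.sqrt_mul (by positivity),
        Real.sqrt_sq hC0, Real.sqrt_sq (by positivity), hD]
      linear_combination (M * C * (ε / (M * (C * volume.real K) + 1))) *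
        Real.mul_self_sqrt (measureReal_nonneg (μ := volume) (s := K))
    _ < ε := by
      rw [mul_div_assoc', div_lt_iff₀ (by positivity)]
      nlinarith

end UniformBounds

section Derivatives

variable {f g : E3 → ℝ}

theorem contDiff_pd {k : ℕ} (hf : ContDiff ℝ (k + 1) f) (α : Fin 3) : ContDiff ℝ k (pd α f) :=
  (hf.fderiv_right le_rfl).clm_apply contDiff_const

theorem pd_mul (hf : Differentiable ℝ f) (hg : Differentiable ℝ g) (α : Fin 3) (x : E3) :
    pd α (fun y => f y * g y) x = pd α f x * g x + f x * pd α g x := by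
  simp only [pd]
  rw [fderiv_fun_mul (hf x) (hg x)]
  simp
  ring

theorem pd_sub (hf : Differentiable ℝ f) (hg : Differentiable ℝ g) (α : Fin 3) (x : E3) :
    pd α (fun y => f y - g y) x = pd α f x - pd α g x := by
  simp only [pd]
  rw [fderiv_fun_sub (hf x) (hg x)]
  simp

theorem pd_eq_zero_of_notMem_tsupport {x : E3} (hx : x ∉ tsupport f) : pd α f x = 0 := by
  rw [pd, image_eq_zero_of_notMem_tsupport fun h => hx (tsupport_fderiv_subset ℝ h)]
  rfl

theorem pd_comm (hf : ContDiff ℝ 2 f) (α β : Fin 3) (x : E3) :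
    pd α (pd β f) x = pd β (pd α f) x := by
  have hd : DifferentiableAt ℝ (fderiv ℝ f) x :=
    (hf.fderiv_right (m := 1) le_rfl).differentiable (by simp) x
  have h : ∀ α β : Fin 3, pd α (pd β f) x =
      fderiv ℝ (fderiv ℝ f) x (Pi.single α 1) (Pi.single β 1) := fun α β => by
    have hpd : pd β f = fun y => fderiv ℝ f y (Pi.single β 1) := rfl
    rw [pd, hpd, fderiv_clm_apply hd (by fun_prop)]
    simp
  rw [h, h]
  exact (hf.contDiffAt.isSymmSndFDerivAt (by simp)).eq _ _

theorem integral_pd_mul (hf : ContDiff ℝ 1 f) (hfc : HasCompactSupport f) (hg : ContDiff ℝ 1 g)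
    (α : Fin 3) : ∫ x, pd α f x * g x = -∫ x, f x * pd α g x := by
  have hpf : Continuous (pd α f) := (contDiff_pd (k := 0) (by simpa using hf) α).continuous
  have hpg : Continuous (pd α g) := (contDiff_pd (k := 0) (by simpa using hg) α).continuous
  have hfpc : HasCompactSupport (pd α f) := hfc.fderiv_apply ℝ _
  have h := integral_mul_fderiv_eq_neg_fderiv_mul_of_integrable (μ := (volume : Measure E3))
    (f := f) (g := g) (v := Pi.single α 1)
    ((hpf.mul hg.continuous).integrable_of_hasCompactSupport hfpc.mul_right)
    ((hf.continuous.mul hpg).integrable_of_hasCompactSupport hfc.mul_right)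
    ((hf.continuous.mul hg.continuous).integrable_of_hasCompactSupport hfc.mul_right)
    (fun x _ => hf.differentiable (by simp) x) (fun x _ => hg.differentiable (by simp) x)
  simp only [pd]
  rw [h, neg_neg]

/-- Exchanging the derivatives in `∂_α θ ∂_β h` up to terms without derivatives on `h`. -/
theorem integral_pd_mul_pd_mul {θ h w : E3 → ℝ} (hθ : ContDiff ℝ 2 θ) (hθc : HasCompactSupport θ)
    (hh : ContDiff ℝ 1 h) (hw : ContDiff ℝ 1 w) (α β : Fin 3) :
    ∫ x, pd α θ x * pd β h x * w x =
      ∫ x, (pd β θ x * pd α h x * w x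
        + (h x * pd β θ x * pd α w x - h x * pd α θ x * pd β w x)) := by
  have hC : ∀ γ, ContDiff ℝ 1 (pd γ θ) := fun γ => contDiff_pd (k := 1) (by exact_mod_cast hθ) γ
  have hcs : ∀ γ, HasCompactSupport (pd γ θ) := fun γ => hθc.fderiv_apply ℝ _
  have hpc : ∀ {k : E3 → ℝ}, ContDiff ℝ 1 k → ∀ γ, Continuous (pd γ k) := fun hk γ =>
    (contDiff_pd (k := 0) (by simpa using hk) γ).continuous
  have key : ∀ γ δ, ∫ x, (pd δ (pd γ θ) x * (h x * w x) + (pd γ θ x * pd δ h x * w x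
      + h x * pd γ θ x * pd δ w x)) = 0 := fun γ δ => by
    have h1 := integral_pd_mul (hC γ) (hcs γ) (hh.mul hw) δ
    rw [eq_neg_iff_add_eq_zero, ← integral_add] at h1
    · rw [← h1]
      congr 1 with x
      rw [pd_mul (hh.differentiable (by simp)) (hw.differentiable (by simp))]
      ring
    · exact ((hpc (hC γ) δ).mul (hh.mul hw).continuous).integrable_of_hasCompactSupport
        (HasCompactSupport.mul_right ((hcs γ).fderiv_apply ℝ _))
    · exact ((hC γ).continuous.mul (hpc (hh.mul hw) δ)).integrable_of_hasCompactSupport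
        (hcs γ).mul_right
  have I1 : ∀ γ δ, Integrable fun x => pd γ θ x * pd δ h x * w x := fun γ δ =>
    (((hC γ).continuous.mul (hpc hh δ)).mul hw.continuous).integrable_of_hasCompactSupport
      (hcs γ).mul_right.mul_right
  have I2 : ∀ γ δ, Integrable fun x => h x * pd γ θ x * pd δ w x := fun γ δ =>
    ((hh.continuous.mul (hC γ).continuous).mul (hpc hw δ)).integrable_of_hasCompactSupport
      (hcs γ).mul_left.mul_right
  have I3 : Integrable fun x => pd β (pd α θ) x * (h x * w x) :=
    ((hpc (hC α) β).mul (hh.continuous.mul hw.continuous)).integrable_of_hasCompactSupport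
      (HasCompactSupport.mul_right ((hcs α).fderiv_apply ℝ _))
  have k1 := key α β
  have k2 := key β α
  simp only [pd_comm hθ α β] at k2
  have I12 := fun γ δ => (I1 γ δ).add (I2 γ δ)
  simp only [Pi.add_def] at I12
  rw [integral_add I3 (I12 α β), integral_add (I1 _ _) (I2 _ _)] at k1
  rw [integral_add I3 (I12 β α), integral_add (I1 _ _) (I2 _ _)] at k2
  have I4 := (I2 β α).sub (I2 α β)
  simp only [Pi.sub_def] at I4
  rw [integral_add (I1 _ _) I4, integral_sub (I2 _ _) (I2 _ _)]
  linarith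

end Derivatives

section MediumTerms

open scoped FourierTransform

variable {K : Set E3} {m : E3 → ℝ}

/-- The terms `∂_α θ_n ∂_β h_n` have vanishing weak limit when `h_n` and `∂_α h_n` are small. -/
theorem tendsto_integral_pd_mul_pd_mul (hK : IsCompact K) {θ h : ℕ → E3 → ℝ} {w : E3 → ℝ}
    {α β : Fin 3} (hθ : ∀ n, ContDiff ℝ 2 (θ n)) (hθK : ∀ n, tsupport (θ n) ⊆ K)
    (hh : ∀ n, ContDiff ℝ 1 (h n)) (hw : ContDiff ℝ 1 w) (hb : ∀ γ, UBdd K (fun n => pd γ (θ n)))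
    (hs : USmall K h) (hs' : USmall K (fun n => pd α (h n))) :
    Tendsto (fun n => ∫ x, pd α (θ n) x * pd β (h n) x * w x) atTop (nhds 0) := by
  have hw0 := UBdd.of_continuous hK hw.continuous
  have hpw : ∀ γ, UBdd K (fun _ => pd γ w) := fun γ =>
    UBdd.of_continuous hK (contDiff_pd (k := 0) (by simpa using hw) γ).continuous
  have h0 : ∀ n, ∀ x ∉ K, ∀ γ, pd γ (θ n) x = 0 := fun n x hx γ =>
    pd_eq_zero_of_notMem_tsupport fun h => hx (hθK n h)
  simp only [fun n => integral_pd_mul_pd_mul (hθ n)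
    (hK.of_isClosed_subset (isClosed_tsupport _) (hθK n)) (hh n) hw α β]
  refine USmall.tendsto_integral hK ?_ fun n x hx => by simp [h0 n x hx]
  refine USmall.congr ((hs'.mul_uBdd ((hb β).mul hw0)).add
    (hs.mul_uBdd (((hb β).mul (hpw α)).sub ((hb α).mul (hpw β))))) fun n x _ => ?_
  ring

theorem tendsto_fourier_lift {g : ℕ → E3 → ℝ} (hg : ∀ n, Continuous (g n))
    (hgc : ∀ n, HasCompactSupport (g n))
    (hlim : ∀ w : E3 → ℝ, ContDiff ℝ 2 w →
      Tendsto (fun n => ∫ x, g n x * w x) atTop (nhds 0)) (ξ : EuclideanSpace ℝ (Fin 3)) :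
    Tendsto (fun n => 𝓕 (lift (g n)) ξ) atTop (nhds 0) := by
  set p : E3 → ℝ := fun x => -2 * π * ∑ i, ξ.ofLp i * x i with hp
  have hpc : ContDiff ℝ 2 p := by
    rw [hp]
    fun_prop
  have heq : ∀ n, 𝓕 (lift (g n)) ξ = ((∫ x, g n x * Real.cos (p x) : ℝ) : ℂ) +
      ((∫ x, g n x * Real.sin (p x) : ℝ) : ℂ) * Complex.I := fun n => by
    have Ic : ∀ q : E3 → ℝ, Continuous q → Integrable fun x => ((g n x * q x : ℝ) : ℂ) :=
      fun q hq => (((hg n).mul hq).integrable_of_hasCompactSupport (hgc n).mul_right).ofReal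
    rw [← integral_complex_ofReal, ← integral_complex_ofReal, ← integral_mul_const,
      ← integral_add (Ic (fun x => Real.cos (p x)) (Real.continuous_cos.comp hpc.continuous))
        ((Ic (fun x => Real.sin (p x)) (Real.continuous_sin.comp hpc.continuous)).mul_const _),
      Real.fourier_eq', ← integral_comp_ofLp]
    congr 1 with v
    have : -2 * π * inner ℝ v ξ = p v.ofLp := by
      simp [hp, PiLp.inner_apply]
    rw [this, Complex.exp_mul_I, lift, smul_eq_mul]
    push_cast
    ring
  simp only [heq]
  have h1 := (Complex.continuous_ofReal.tendsto 0).comp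
    (hlim _ (Real.contDiff_cos.comp hpc))
  have h2 := (Complex.continuous_ofReal.tendsto 0).comp
    (hlim _ (Real.contDiff_sin.comp hpc))
  simpa using h1.add (h2.mul_const Complex.I)

theorem lift_mul (f g : E3 → ℝ) :
    lift (fun x => f x * g x) = fun v => lift f v * lift g v :=
  funext fun _ => Complex.ofReal_mul _ _

theorem lift_sub (f g : E3 → ℝ) :
    lift (fun x => f x - g x) = fun v => lift f v - lift g v :=
  funext fun _ => Complex.ofReal_sub _ _

/-- The commutator argument for a single spatial index, in terms of the bilinear form of the
multiplier. -/
theorem tendsto_mulForm_medium (hm : SymbolOrder0 m) (hmeven : ∀ ξ, m (-ξ) = m ξ)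
    (hK : IsCompact K) {c : ℝ} (hc : 0 < c) {b N₀ E₀ : E3 → ℝ} {u N E : ℕ → E3 → ℝ}
    (hb : ContDiff ℝ 2 b) (hbc : HasCompactSupport b) (hN₀ : ContDiff ℝ 2 N₀)
    (hE₀ : ContDiff ℝ 2 E₀) (hu : ∀ n, ContDiff ℝ 2 (u n)) (hN : ∀ n, ContDiff ℝ 2 (N n))
    (hE : ∀ n, ContDiff ℝ 2 (E n)) (hN₀pos : ∀ x, 0 < N₀ x) (hNpos : ∀ n x, 0 < N n x)
    (hN₀c : ∀ x ∈ K, c ≤ N₀ x) (hNc : ∀ n, ∀ x ∈ K, c ≤ N n x)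
    (hu0 : ∀ n, ∀ x ∉ K, u n x = 0) (hub : UBdd K u) (hEb : UBdd K E)
    (hNs : USmall K (fun n x => N n x - N₀ x))
    (hlim : ∀ w : E3 → ℝ, ContDiff ℝ 2 w →
      Tendsto (fun n => ∫ x, u n x * (E n x - E₀ x) * w x) atTop (nhds 0)) :
    Tendsto (fun n =>
      mulForm (liftSymbol m) (lift fun x => u n x * E n x * b x) (lift fun x => u n x / N n x)
      - mulForm (liftSymbol m) (lift fun x => u n x * N₀ x * b x)
        (lift fun x => E n x * u n x / N n x ^ 2)
      - mulForm (liftSymbol m) (lift fun x => u n x * E₀ x * b x) (lift fun x => u n x / N₀ x)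
      + mulForm (liftSymbol m) (lift fun x => u n x * N₀ x * b x)
        (lift fun x => E₀ x * u n x / N₀ x ^ 2)) atTop (nhds 0) := by
  obtain ⟨M, hM⟩ := hm.exists_bound
  have hμ := hm.continuous_liftSymbol
  have hN₀' : ∀ x, N₀ x ≠ 0 := fun x => (hN₀pos x).ne'
  have hN' : ∀ n x, N n x ≠ 0 := fun n x => (hNpos n x).ne'
  have huc : ∀ n, HasCompactSupport (u n) := fun n =>
    HasCompactSupport.of_support_subset_isCompact hK fun x hx => by
      by_contra h
      exact hx (hu0 n x h)
  have nice : ∀ n {q : E3 → ℝ} {f : E3 → ℝ}, ContDiff ℝ 2 q → (∀ x, f x = u n x * q x) →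
      FourierNice (lift f) := fun n q f hq hf => by
    rw [funext hf]
    exact lift_fourierNice ((hu n).mul hq) (huc n).mul_right
  have hbb := UBdd.of_continuous hK hb.continuous
  have hN₀b := UBdd.of_continuous hK hN₀.continuous
  have hE₀b := UBdd.of_continuous hK hE₀.continuous
  have hNi : UBdd K (fun n x => (N n x)⁻¹) := UBdd.inv_of_le hc hNc
  have hN₀i : UBdd K (fun _ x => (N₀ x)⁻¹) := UBdd.inv_of_le hc fun _ => hN₀c
  have cN₀i : ContDiff ℝ 2 (fun x => (N₀ x)⁻¹) := hN₀.inv hN₀'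
  have cNi : ∀ n, ContDiff ℝ 2 (fun x => (N n x)⁻¹) := fun n => (hN n).inv (hN' n)
  have hF := hEb.sub hE₀b
  set g : ℕ → E3 → ℝ := fun n x => u n x * (E n x - E₀ x) * (N₀ x)⁻¹ ^ 2 with hg
  set v : ℕ → E3 → ℝ := fun n x => u n x / N₀ x with hv
  set a : E3 → ℝ := fun x => b x * N₀ x ^ 2 with ha
  have n1 : ∀ n, FourierNice (lift fun x => u n x * E n x * b x) := fun n =>
    nice n ((hE n).mul hb) fun x => by ring
  have n2 : ∀ n, FourierNice (lift fun x => u n x * N₀ x * b x) := fun n =>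
    nice n (hN₀.mul hb) fun x => by ring
  have n3 : ∀ n, FourierNice (lift fun x => u n x * E₀ x * b x) := fun n =>
    nice n (hE₀.mul hb) fun x => by ring
  have n4 : ∀ n, FourierNice (lift (v n)) := fun n => nice n cN₀i fun x => by
    simp only [hv, div_eq_mul_inv]
  have n5 : ∀ n, FourierNice (lift fun x => u n x / N n x) := fun n => nice n (cNi n) fun x => by
    simp only [div_eq_mul_inv]
  have n6 : ∀ n, FourierNice (lift fun x => E n x * u n x / N n x ^ 2) := fun n =>
    nice n ((hE n).mul ((cNi n).pow 2)) fun x => by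
      rw [div_eq_mul_inv, ← inv_pow]
      ring
  have n7 : ∀ n, FourierNice (lift fun x => E n x * u n x / N₀ x ^ 2) := fun n =>
    nice n ((hE n).mul (cN₀i.pow 2)) fun x => by
      rw [div_eq_mul_inv, ← inv_pow]
      ring
  have n8 : ∀ n, FourierNice (lift fun x => E₀ x * u n x / N₀ x ^ 2) := fun n =>
    nice n (hE₀.mul (cN₀i.pow 2)) fun x => by
      rw [div_eq_mul_inv, ← inv_pow]
      ring
  have n9 : ∀ n, FourierNice (lift (g n)) := fun n =>
    nice n (((hE n).sub hE₀).mul (cN₀i.pow 2)) fun x => by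
      simp only [hg]
      ring
  have hgK : UBdd K g := by
    have := (hub.mul hF).mul (hN₀i.mul hN₀i)
    simpa only [hg, pow_two] using this
  have hvK : UBdd K v := by simpa only [hv, div_eq_mul_inv] using hub.mul hN₀i
  have hg0 : ∀ n, ∀ x ∉ K, g n x = 0 := fun n x hx => by simp [hg, hu0 n x hx]
  have hv0 : ∀ n, ∀ x ∉ K, v n x = 0 := fun n x hx => by simp [hv, hu0 n x hx]
  have T1 : Tendsto (fun n => mulForm (liftSymbol m) (lift fun x => u n x * E n x * b x)
      (lift fun x => u n x / N n x - v n x)) atTop (nhds 0) := by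
    refine tendsto_mulForm_lift hM hK ((hub.mul hEb).mul hbb) ?_ n1 (fun n => ?_)
      (fun n x hx => by simp [hu0 n x hx]) (fun n x hx => by simp [hu0 n x hx, hv])
    · refine USmall.congr (hNs.mul_uBdd ((hub.mul hN₀i).mul (hNi.mul (UBdd.of_continuous hK
        (continuous_const (y := (-1 : ℝ))))))) fun n x _ => ?_
      have := hN₀' x
      have := hN' n x
      simp only [hv]
      field_simp
      ring
    · rw [lift_sub]
      exact (n5 n).sub (n4 n)
  have T2 : Tendsto (fun n => mulForm (liftSymbol m) (lift fun x => u n x * N₀ x * b x)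
      (lift fun x => E n x * u n x / N n x ^ 2 - E n x * u n x / N₀ x ^ 2)) atTop (nhds 0) := by
    refine tendsto_mulForm_lift hM hK ((hub.mul hN₀b).mul hbb) ?_ n2 (fun n => ?_)
      (fun n x hx => by simp [hu0 n x hx]) (fun n x hx => by simp [hu0 n x hx])
    · refine USmall.congr (hNs.mul_uBdd ((hub.mul hEb).mul (((hNi.mul hNi).mul hN₀i).add
        ((hN₀i.mul hN₀i).mul hNi) |>.mul (UBdd.of_continuous hK
        (continuous_const (y := (-1 : ℝ))))))) fun n x _ => ?_
      have := hN₀' x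
      have := hN' n x
      field_simp
      ring
    · rw [lift_sub]
      exact (n6 n).sub (n7 n)
  have T3 : Tendsto (fun n => mulForm (liftSymbol m) (fun x => lift a x * lift (g n) x)
      (lift (v n)) - mulForm (liftSymbol m) (lift (g n)) (fun x => lift a x * lift (v n) x))
      atTop (nhds 0) := by
    obtain ⟨C, hC0, hC⟩ := hgK.exists_nonneg
    obtain ⟨D, hD0, hD⟩ := hvK.exists_nonneg
    have hV : 0 ≤ volume.real K := measureReal_nonneg
    refine tendsto_mulForm_commutator (C := (C + D + C ^ 2 + D ^ 2) * volume.real K) hμ hM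
      hm.tendsto_liftSymbol_sub (lift_fourierNice (hb.mul (hN₀.pow 2)) hbc.mul_right) n9 n4
      (fun n => (integral_norm_lift_le hK (hC n) (hg0 n)).trans ?_)
      (fun n => (integral_norm_lift_le hK (hD n) (hv0 n)).trans ?_)
      (fun n => (integral_norm_sq_lift_le hK (hC n) (hg0 n)).trans ?_)
      (fun n => (integral_norm_sq_lift_le hK (hD n) (hv0 n)).trans ?_)
      (tendsto_fourier_lift (fun n => ?_) (fun n => ?_) fun w hw => ?_)
    any_goals exact mul_le_mul_of_nonneg_right (by nlinarith [sq_nonneg C, sq_nonneg D]) hV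
    · exact (((hu n).mul ((hE n).sub hE₀)).mul (cN₀i.pow 2)).continuous
    · exact (huc n).mul_right.mul_right
    · refine (hlim _ ((cN₀i.pow 2).mul hw)).congr fun n => ?_
      congr 1 with x
      simp only [hg]
      ring
  have T := (T1.sub T2).add T3
  simp only [sub_zero, add_zero] at T
  refine T.congr fun n => ?_
  have e1 : (fun x => lift a x * lift (g n) x) =
      fun x => lift (fun x => u n x * E n x * b x) x - lift (fun x => u n x * E₀ x * b x) x := by
    rw [← lift_mul, ← lift_sub]
    congr 1 with x
    have := hN₀' x
    simp only [ha, hg]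
    field_simp
  have e2 : (fun x => lift a x * lift (v n) x) = lift fun x => u n x * N₀ x * b x := by
    rw [← lift_mul]
    congr 1 with x
    have := hN₀' x
    simp only [ha, hv]
    field_simp
  have e3 : lift (g n) = fun x => lift (fun x => E n x * u n x / N₀ x ^ 2) x -
      lift (fun x => E₀ x * u n x / N₀ x ^ 2) x := by
    rw [← lift_sub]
    congr 1 with x
    have := hN₀' x
    simp only [hg]
    field_simp
  have heven : ∀ ξ, liftSymbol m (-ξ) = liftSymbol m ξ := fun ξ => by
    simp [liftSymbol, hmeven]
  rw [mulForm_comm heven (f := lift (g n)), e1, e2, e3, lift_sub, lift_sub,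
    mulForm_sub_right hμ hM (n1 n) (n5 n) (n4 n), mulForm_sub_right hμ hM (n2 n) (n6 n) (n7 n),
    mulForm_sub_right hμ hM (n2 n) (n7 n) (n8 n), mulForm_sub_left hμ hM (n1 n) (n3 n) (n4 n)]
  ring

theorem contDiff_e0 {k : ℕ} {b : Fin 2 → E3 → ℝ} {f : E3 → ℝ} (hb : ∀ i, ContDiff ℝ k (b i))
    (hf : ContDiff ℝ (k + 1) f) : ContDiff ℝ k (e0 b f) :=
  (contDiff_pd hf 0).sub (((hb 0).mul (contDiff_pd hf 1)).add ((hb 1).mul (contDiff_pd hf 2)))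

/-- The weak limit of the product of a spatial derivative with `e₀` of the lapse. -/
theorem tendsto_integral_pd_mul_e0_sub (hK : IsCompact K) {θ N : ℕ → E3 → ℝ} {N₀ w : E3 → ℝ}
    {b : ℕ → Fin 2 → E3 → ℝ} {b₀ : Fin 2 → E3 → ℝ} (i : Fin 2) (hθ : ∀ n, ContDiff ℝ 2 (θ n))
    (hθK : ∀ n, tsupport (θ n) ⊆ K) (hN : ∀ n, ContDiff ℝ 1 (N n)) (hN₀ : ContDiff ℝ 1 N₀)
    (hb : ∀ n i, Continuous (b n i)) (hb₀ : ∀ i, Continuous (b₀ i)) (hw : ContDiff ℝ 1 w)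
    (hθb : ∀ γ, UBdd K (fun n => pd γ (θ n))) (hNs : USmall K (fun n x => N n x - N₀ x))
    (hNs' : ∀ j, USmall K (fun n => pd (sp j) (fun x => N n x - N₀ x)))
    (hbs : ∀ j, USmall K (fun n x => b n j x - b₀ j x)) (hbb : ∀ j, UBdd K (fun n => b n j)) :
    Tendsto (fun n => ∫ x, pd (sp i) (θ n) x * (e0 (b n) (N n) x - e0 b₀ N₀ x) * w x)
      atTop (nhds 0) := by
  have hθc : ∀ n, HasCompactSupport (θ n) := fun n =>
    hK.of_isClosed_subset (isClosed_tsupport _) (hθK n)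
  have hpc : ∀ {f : E3 → ℝ}, ContDiff ℝ 1 f → ∀ γ, Continuous (pd γ f) := fun hf γ =>
    (contDiff_pd (k := 0) (by simpa using hf) γ).continuous
  have hθ1 : ∀ n, ContDiff ℝ 1 (θ n) := fun n => (hθ n).of_le (by norm_num)
  have hpN₀ : ∀ γ, UBdd K (fun _ => pd γ N₀) := fun γ => UBdd.of_continuous hK (hpc hN₀ γ)
  have hsub : ∀ n γ x, pd γ (fun x => N n x - N₀ x) x = pd γ (N n) x - pd γ N₀ x := fun n γ x =>
    pd_sub ((hN n).differentiable (by simp)) (hN₀.differentiable (by simp)) γ x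
  set r : ℕ → E3 → ℝ := fun n x => (b n 0 x * pd (sp 0) (fun x => N n x - N₀ x) x +
      b n 1 x * pd (sp 1) (fun x => N n x - N₀ x) x) + ((b n 0 x - b₀ 0 x) * pd (sp 0) N₀ x +
      (b n 1 x - b₀ 1 x) * pd (sp 1) N₀ x) with hr
  have hrs : USmall K r :=
    (((hbb 0).mul_uSmall (hNs' 0)).add ((hbb 1).mul_uSmall (hNs' 1))).add
      (((hbs 0).mul_uBdd (hpN₀ _)).add ((hbs 1).mul_uBdd (hpN₀ _)))
  have hrc : ∀ n, Continuous (r n) := fun n => by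
    have hd := fun γ => hpc ((hN n).sub hN₀) γ
    exact (((hb n 0).mul (hd _)).add ((hb n 1).mul (hd _))).add
      ((((hb n 0).sub (hb₀ 0)).mul (hpc hN₀ _)).add (((hb n 1).sub (hb₀ 1)).mul (hpc hN₀ _)))
  have hF : ∀ n x, e0 (b n) (N n) x - e0 b₀ N₀ x =
      pd 0 (fun x => N n x - N₀ x) x - r n x := fun n x => by
    simp only [hr, hsub, e0, sp, Matrix.cons_val_zero, Matrix.cons_val_one]
    ring
  have L1 := tendsto_integral_pd_mul_pd_mul (α := sp i) (β := 0) hK hθ hθK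
    (fun n => (hN n).sub hN₀) hw hθb hNs (hNs' i)
  have L2 : Tendsto (fun n => ∫ x, pd (sp i) (θ n) x * r n x * w x) atTop (nhds 0) := by
    refine USmall.tendsto_integral hK (((hθb _).mul_uSmall hrs).mul_uBdd
      (UBdd.of_continuous hK hw.continuous)) fun n x hx => ?_
    rw [pd_eq_zero_of_notMem_tsupport fun h => hx (hθK n h), zero_mul, zero_mul]
  have L := L1.sub L2
  rw [sub_zero] at L
  refine L.congr fun n => ?_
  have hs : HasCompactSupport (pd (sp i) (θ n)) := (hθc n).fderiv_apply ℝ _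
  rw [← integral_sub]
  · congr 1 with x
    rw [hF]
    ring
  · exact (((hpc (hθ1 n) _).mul (hpc ((hN n).sub hN₀) _)).mul
      hw.continuous).integrable_of_hasCompactSupport hs.mul_right.mul_right
  · exact (((hpc (hθ1 n) _).mul (hrc n)).mul
      hw.continuous).integrable_of_hasCompactSupport hs.mul_right.mul_right

end MediumTerms

/-- Proposition `prop:main.medium` of Huneau–Luk: the "medium" terms
combine, along a subsequence, to give zero in the limit. -/
theorem stmt12
    (lam : ℕ → ℝ) (hlam : ∀ n, lam n ∈ Set.Ioc (0 : ℝ) 1)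
    (hlam0 : Tendsto lam atTop (nhds 0))
    (χ b : E3 → ℝ)
    (hχ : ContDiff ℝ (⊤ : ℕ∞) χ) (hχc : HasCompactSupport χ)
    (hb : ContDiff ℝ (⊤ : ℕ∞) b) (hbc : HasCompactSupport b)
    (m : E3 → ℝ) (hm : SymbolOrder0 m) (hmeven : ∀ ξ, m (-ξ) = m ξ)
    (K : Set E3) (hK : IsCompact K) (hχK : tsupport χ ⊆ interior K)
    (c : ℝ) (hc : 0 < c)
    (ψ Nn : ℕ → E3 → ℝ) (bn : ℕ → Fin 2 → E3 → ℝ)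
    (ψ₀ N₀ : E3 → ℝ) (b₀ : Fin 2 → E3 → ℝ)
    (hreg : ∀ n, ContDiff ℝ 4 (ψ n) ∧ ContDiff ℝ 4 (Nn n) ∧ ∀ i, ContDiff ℝ 4 (bn n i))
    (hlimreg : ContDiff ℝ (⊤ : ℕ∞) ψ₀ ∧ ContDiff ℝ (⊤ : ℕ∞) N₀ ∧
      ∀ i, ContDiff ℝ (⊤ : ℕ∞) (b₀ i))
    (hNpos : ∀ n x, 0 < Nn n x) (hN₀pos : ∀ x, 0 < N₀ x)
    (hNc : ∀ n, ∀ x ∈ K, c ≤ Nn n x) (hN₀c : ∀ x ∈ K, c ≤ N₀ x)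
    -- O(λₙ) closeness in L^∞(K)
    (hclose : ∃ C : ℝ, ∀ n, ∀ x ∈ K,
      |ψ n x - ψ₀ x| ≤ C * lam n ∧ |Nn n x - N₀ x| ≤ C * lam n ∧
      ∀ i, |bn n i x - b₀ i x| ≤ C * lam n)
    -- O(1) bounds on first derivatives in L^∞(K)
    (hD1 : ∃ C : ℝ, ∀ n, ∀ α : Fin 3, ∀ x ∈ K,
      |pd α (ψ n) x| ≤ C ∧ |pd α (Nn n) x| ≤ C ∧ ∀ i, |pd α (bn n i) x| ≤ C)
    -- spatial derivatives of Nₙ − N₀ converge uniformly to 0 on K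
    (hspatial : ∀ i : Fin 2,
      TendstoUniformlyOn (fun n => pd (sp i) (fun y => Nn n y - N₀ y)) 0 atTop K) :
    ∃ φ : ℕ → ℕ, StrictMono φ ∧
      Tendsto (fun k =>
        (∫ x : E3, ∑ i : Fin 2,
          ((pd (sp i) (fun y => χ y * ψ (φ k) y) x * e0 (bn (φ k)) (Nn (φ k)) x : ℝ) : ℂ)
            * ((b x : ℝ) : ℂ)
            * FMul m (fun y => pd (sp i) (fun z => χ z * ψ (φ k) z) y / Nn (φ k) y) x)
        - (∫ x : E3, ∑ i : Fin 2,
          ((pd (sp i) (fun y => χ y * ψ (φ k) y) x * N₀ x : ℝ) : ℂ)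
            * ((b x : ℝ) : ℂ)
            * FMul m (fun y => e0 (bn (φ k)) (Nn (φ k)) y
                * pd (sp i) (fun z => χ z * ψ (φ k) z) y / (Nn (φ k) y) ^ 2) x)
        - (∫ x : E3, ∑ i : Fin 2,
          ((pd (sp i) (fun y => χ y * ψ (φ k) y) x * e0 b₀ N₀ x : ℝ) : ℂ)
            * ((b x : ℝ) : ℂ)
            * FMul m (fun y => pd (sp i) (fun z => χ z * ψ (φ k) z) y / N₀ y) x)
        + (∫ x : E3, ∑ i : Fin 2,
          ((pd (sp i) (fun y => χ y * ψ (φ k) y) x * N₀ x : ℝ) : ℂ)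
            * ((b x : ℝ) : ℂ)
            * FMul m (fun y => e0 b₀ N₀ y
                * pd (sp i) (fun z => χ z * ψ (φ k) z) y / (N₀ y) ^ 2) x))
        atTop (nhds 0) := by
  refine ⟨id, strictMono_id, ?_⟩
  simp only [id]
  obtain ⟨hψ₀, hN₀, hb₀⟩ := hlimreg
  obtain ⟨C, hC⟩ := hclose
  obtain ⟨D, hD⟩ := hD1
  obtain ⟨M, hM⟩ := hm.exists_bound
  have hμ := hm.continuous_liftSymbol
  have hχK' : tsupport χ ⊆ K := hχK.trans interior_subset
  have top_le : ∀ k : ℕ, ((k : ℕ∞) : WithTop ℕ∞) ≤ ((⊤ : ℕ∞) : WithTop ℕ∞) := fun k =>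
    WithTop.coe_le_coe.2 le_top
  have smooth : ∀ {f : E3 → ℝ}, ContDiff ℝ (⊤ : ℕ∞) f → ∀ k : ℕ, ContDiff ℝ k f :=
    fun hf k => hf.of_le (top_le k)
  have hψc : ∀ n, ContDiff ℝ 4 (ψ n) := fun n => (hreg n).1
  have hNc4 : ∀ n, ContDiff ℝ 4 (Nn n) := fun n => (hreg n).2.1
  have hbc4 : ∀ n i, ContDiff ℝ 4 (bn n i) := fun n => (hreg n).2.2
  set θ : ℕ → E3 → ℝ := fun n y => χ y * ψ n y with hθ
  have hθc : ∀ n, ContDiff ℝ 4 (θ n) := fun n => (smooth hχ 4).mul (hψc n)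
  have hθK : ∀ n, tsupport (θ n) ⊆ K := fun n => (tsupport_mul_subset_left).trans hχK'
  have hu : ∀ n γ, ContDiff ℝ 3 (pd γ (θ n)) := fun n γ => contDiff_pd (k := 3) (hθc n) γ
  have hu0 : ∀ n γ, ∀ x ∉ K, pd γ (θ n) x = 0 := fun n γ x hx =>
    pd_eq_zero_of_notMem_tsupport fun h => hx (hθK n h)
  have hNs : USmall K (fun n x => Nn n x - N₀ x) :=
    USmall.of_le hlam0 fun n x hx => (hC n x hx).2.1
  have hbs : ∀ j, USmall K (fun n x => bn n j x - b₀ j x) := fun j =>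
    USmall.of_le hlam0 fun n x hx => (hC n x hx).2.2 j
  have bdd : ∀ {f : ℕ → E3 → ℝ} {f₀ : E3 → ℝ}, Continuous f₀ →
      (∀ n, ∀ x ∈ K, |f n x - f₀ x| ≤ C * lam n) → UBdd K f := fun {f f₀} hf₀ h => by
    have h1 : UBdd K (fun n x => f n x - f₀ x) := ⟨|C|, fun n x hx => (h n x hx).trans <|
      (mul_le_mul_of_nonneg_right (le_abs_self C) (hlam n).1.le).trans
        (mul_le_of_le_one_right (abs_nonneg C) (hlam n).2)⟩
    simpa using h1.add (UBdd.of_continuous hK hf₀)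
  have hψb : UBdd K ψ := bdd hψ₀.continuous fun n x hx => (hC n x hx).1
  have hbb : ∀ j, UBdd K (fun n => bn n j) := fun j =>
    bdd (hb₀ j).continuous fun n x hx => (hC n x hx).2.2 j
  have hpN : ∀ γ, UBdd K (fun n => pd γ (Nn n)) := fun γ => ⟨D, fun n x hx => (hD n γ x hx).2.1⟩
  have hub : ∀ γ, UBdd K (fun n => pd γ (θ n)) := fun γ => by
    have h1 : UBdd K (fun n => pd γ (ψ n)) := ⟨D, fun n x hx => (hD n γ x hx).1⟩
    have h2 := ((UBdd.of_continuous hK (contDiff_pd (smooth hχ 1) γ (k := 0)).continuous).mul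
      hψb).add ((UBdd.of_continuous hK hχ.continuous).mul h1)
    have h3 : ∀ n x, pd γ (θ n) x = pd γ χ x * ψ n x + χ x * pd γ (ψ n) x := fun n x =>
      pd_mul (hχ.differentiable (by simp)) ((hψc n).differentiable (by simp)) γ x
    simpa only [← h3] using h2
  have hE : ∀ n, ContDiff ℝ 2 (e0 (bn n) (Nn n)) := fun n =>
    contDiff_e0 (k := 2) (fun i => (hbc4 n i).of_le (by norm_num))
      ((hNc4 n).of_le (by norm_num))
  have hE₀ : ContDiff ℝ 2 (e0 b₀ N₀) :=
    contDiff_e0 (k := 2) (fun i => smooth (hb₀ i) 2) (smooth hN₀ 3)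
  have hEb : UBdd K (fun n => e0 (bn n) (Nn n)) :=
    (hpN 0).sub (((hbb 0).mul (hpN 1)).add ((hbb 1).mul (hpN 2)))
  have hu2 : ∀ n γ, ContDiff ℝ 2 (pd γ (θ n)) := fun n γ => (hu n γ).of_le (by norm_num)
  have hN2 : ∀ n, ContDiff ℝ 2 (Nn n) := fun n => (hNc4 n).of_le (by norm_num)
  have hucs : ∀ n γ, HasCompactSupport (pd γ (θ n)) := fun n γ =>
    HasCompactSupport.fderiv_apply ℝ
      (hK.of_isClosed_subset (isClosed_tsupport _) (hθK n)) _
  have hsum := tendsto_finsetSum Finset.univ fun (i : Fin 2) _ =>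
    tendsto_mulForm_medium hm hmeven hK hc (smooth hb 2) hbc (smooth hN₀ 2) hE₀
      (fun n => hu2 n (sp i)) hN2 hE hN₀pos hNpos hN₀c hNc (fun n => hu0 n (sp i)) (hub (sp i))
      hEb hNs fun w hw => tendsto_integral_pd_mul_e0_sub hK i
        (fun n => (hθc n).of_le (by norm_num)) hθK (fun n => (hNc4 n).of_le (by norm_num))
        (smooth hN₀ 1) (fun n i => (hbc4 n i).continuous) (fun i => (hb₀ i).continuous)
        (hw.of_le (by norm_num)) hub hNs (fun j => .of_tendstoUniformlyOn (hspatial j)) hbs hbb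
  rw [Finset.sum_const_zero] at hsum
  refine hsum.congr fun n => ?_
  have hN₀' : ∀ x, N₀ x ≠ 0 := fun x => (hN₀pos x).ne'
  have hN' : ∀ x, Nn n x ≠ 0 := fun x => (hNpos n x).ne'
  have hN₀2 := smooth hN₀ 2
  have hb2 := smooth hb 2
  have rep : ∀ {p q : E3 → ℝ} {f g : Fin 2 → E3 → ℝ}, ContDiff ℝ 2 p → ContDiff ℝ 2 q →
      (∀ i x, f i x = pd (sp i) (θ n) x * p x) → (∀ i x, g i x = pd (sp i) (θ n) x * q x) →
      ∑ i, mulForm (liftSymbol m) (lift (f i)) (lift (g i)) =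
        ∫ x, ∑ i, (f i x : ℂ) * FMul m (g i) x := fun {p q f g} hp hq hf hg => by
    rw [funext fun i => funext (hf i), funext fun i => funext (hg i)]
    exact (integral_sum_mul_FMul hμ hM (fun i => (hu2 n (sp i)).mul hp)
      (fun i => (hucs n (sp i)).mul_right) (fun i => (hu2 n (sp i)).mul hq)
      fun i => (hucs n (sp i)).mul_right).symm
  simp only [← Complex.ofReal_mul]
  rw [Finset.sum_add_distrib, Finset.sum_sub_distrib, Finset.sum_sub_distrib]
  refine congrArg₂ (· + ·) (congrArg₂ (· - ·) (congrArg₂ (· - ·) ?_ ?_) ?_) ?_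
  · exact rep ((hE n).mul hb2) ((hN2 n).inv hN') (fun _ _ => mul_assoc _ _ _)
      fun _ _ => div_eq_mul_inv _ _
  · exact rep (hN₀2.mul hb2) ((hE n).div ((hN2 n).pow 2) fun x => pow_ne_zero 2 (hN' x))
      (fun _ _ => mul_assoc _ _ _) fun _ _ => by
        rw [Pi.div_apply, mul_div_assoc', mul_comm]
  · exact rep (hE₀.mul hb2) (hN₀2.inv hN₀') (fun _ _ => mul_assoc _ _ _)
      fun _ _ => div_eq_mul_inv _ _
  · exact rep (hN₀2.mul hb2) (hE₀.div (hN₀2.pow 2) fun x => pow_ne_zero 2 (hN₀' x))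
      (fun _ _ => mul_assoc _ _ _) fun _ _ => by
        rw [Pi.div_apply, mul_div_assoc', mul_comm]

end
end

section
/- Let φ and w be real-valued Schwartz functions on ℝ³ = ℝ_t×ℝ²_x, let β¹,β²∈ℝ be constants, and let m̃:ℝ³→ℝ be smooth with all derivatives bounded and even (m̃(−ξ)=m̃(ξ)). Write dual variables as ξ=(ξ_t,ξ₁,ξ₂), η=(η_t,η₁,η₂), and |ξ_i|² := ξ₁²+ξ₂², |η_i|² := η₁²+η₂². Then the following identity holds: ∫_{ℝ³} ((∂_t−β^k∂_k)φ)(x) · Σ_{i=1}^{2} [ w(x)·(m̃((1/i)∇)(∂²_{ii}φ))(x) − (m̃((1/i)∇)(w·∂²_{ii}φ))(x) ] dx = −(i/2)·(2π)^{−3/2} ∬_{ℝ³×ℝ³} [ (ξ_t−β^kξ_k)|η_i|² + (η_t−β^kη_k)|ξ_i|² ] · φ̂(ξ)·ŵ(η−ξ)·φ̂(−η)·(m̃(η)−m̃(ξ)) dη dξ, where ∂_k (k=1,2) are spatial derivatives and ∂²_{ii} = ∂²/∂(x^i)². -/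
open MeasureTheory Real Filter Complex
open scoped ENNReal

noncomputable section

open SchwartzMap FourierTransform LineDeriv

/-- A complex function on space-time that underlies a Schwartz map. -/
def IsSchwartz (f : E3 → ℂ) : Prop := ∃ F : SchwartzMap E3 ℂ, ⇑F = f

namespace IsSchwartz

variable {f g : E3 → ℂ}

lemma integrable (hf : IsSchwartz f) : Integrable f := by
  obtain ⟨F, rfl⟩ := hf
  exact F.integrable

lemma continuous (hf : IsSchwartz f) : Continuous f := by
  obtain ⟨F, rfl⟩ := hf
  exact F.continuous

lemma exists_norm_le (hf : IsSchwartz f) : ∃ C, ∀ x, ‖f x‖ ≤ C := by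
  obtain ⟨F, rfl⟩ := hf
  exact ⟨_, F.toBoundedContinuousFunction.norm_coe_le_norm⟩

lemma add (hf : IsSchwartz f) (hg : IsSchwartz g) : IsSchwartz (fun x => f x + g x) := by
  obtain ⟨F, rfl⟩ := hf
  obtain ⟨G, rfl⟩ := hg
  exact ⟨F + G, rfl⟩

lemma sub (hf : IsSchwartz f) (hg : IsSchwartz g) : IsSchwartz (fun x => f x - g x) := by
  obtain ⟨F, rfl⟩ := hf
  obtain ⟨G, rfl⟩ := hg
  exact ⟨F - G, rfl⟩

lemma const_mul (c : ℂ) (hf : IsSchwartz f) : IsSchwartz (fun x => c * f x) := by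
  obtain ⟨F, rfl⟩ := hf
  exact ⟨c • F, rfl⟩

lemma temperate_mul {u : E3 → ℂ} (hu : u.HasTemperateGrowth) (hf : IsSchwartz f) :
    IsSchwartz (fun x => u x * f x) := by
  obtain ⟨F, rfl⟩ := hf
  exact ⟨smulLeftCLM ℂ u F, by simp [smulLeftCLM_apply hu]⟩

lemma mul (hf : IsSchwartz f) (hg : IsSchwartz g) : IsSchwartz (fun x => f x * g x) := by
  obtain ⟨F, rfl⟩ := hf
  exact temperate_mul F.hasTemperateGrowth hg

lemma comp_neg (hf : IsSchwartz f) : IsSchwartz (fun x => f (-x)) := by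
  obtain ⟨F, rfl⟩ := hf
  exact ⟨compCLMOfContinuousLinearEquiv ℂ (ContinuousLinearEquiv.neg ℝ) F, by ext; simp⟩

end IsSchwartz

lemma isSchwartz_ofReal (f : SchwartzMap E3 ℝ) : IsSchwartz (fun x => (f x : ℂ)) :=
  ⟨postcompCLM Complex.ofRealCLM f, by ext; simp⟩

/-- The transfer of a Schwartz map to Euclidean space. -/
def schwartzToEuclidean (f : SchwartzMap E3 ℂ) : SchwartzMap (EuclideanSpace ℝ (Fin 3)) ℂ :=
  compCLMOfContinuousLinearEquiv ℂ (EuclideanSpace.equiv (Fin 3) ℝ) f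

lemma schwartzToEuclidean_apply (f : SchwartzMap E3 ℂ) (v : EuclideanSpace ℝ (Fin 3)) :
    schwartzToEuclidean f v = f (WithLp.ofLp v) := rfl

lemma integral_euclidean (h : EuclideanSpace ℝ (Fin 3) → ℂ) :
    ∫ v, h v = ∫ x : E3, h (WithLp.toLp 2 x) :=
  ((PiLp.volume_preserving_toLp (Fin 3)).integral_comp
    (MeasurableEquiv.toLp 2 (Fin 3 → ℝ)).measurableEmbedding h).symm

lemma FT_eq_fourier_s15 (f : SchwartzMap E3 ℂ) (ξ : E3) :
    FT f ξ = (((2 * π) ^ (-(3 : ℝ) / 2) : ℝ) : ℂ) *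
      𝓕 (schwartzToEuclidean f) ((2 * π)⁻¹ • WithLp.toLp 2 ξ) := by
  rw [FT, fourier_coe, Real.fourier_eq', integral_euclidean]
  congr 2 with x
  rw [schwartzToEuclidean_apply, smul_eq_mul]
  congr 2
  simp only [PiLp.inner_apply, PiLp.smul_apply, smul_eq_mul, Fin.sum_univ_three,
    RCLike.inner_apply, conj_trivial]
  push_cast
  have : (π : ℂ) ≠ 0 := by exact_mod_cast pi_ne_zero
  field_simp

lemma IsSchwartz.FT {f : E3 → ℂ} (hf : IsSchwartz f) : IsSchwartz (FT f) := by
  obtain ⟨F, rfl⟩ := hf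
  refine ⟨(((2 * π) ^ (-(3 : ℝ) / 2) : ℝ) : ℂ) • compCLMOfContinuousLinearEquiv ℂ
    ((EuclideanSpace.equiv (Fin 3) ℝ).symm.trans (ContinuousLinearEquiv.smulLeft
      (Units.mk0 ((2 * π)⁻¹ : ℝ) (by positivity)))) (𝓕 (schwartzToEuclidean F)), ?_⟩
  ext ξ
  rw [FT_eq_fourier_s15]
  rfl

lemma two_pi_rpow_mul_self :
    ((2 * π) ^ (-(3 : ℝ) / 2) : ℝ) * (2 * π) ^ (-(3 : ℝ) / 2) = ((2 * π) ^ 3)⁻¹ := by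
  rw [← Real.rpow_add (by positivity), ← Real.rpow_natCast, ← Real.rpow_neg (by positivity)]
  norm_num

lemma IsSchwartz.inversion {f : E3 → ℂ} (hf : IsSchwartz f) (x : E3) :
    f x = (((2 * π) ^ (-(3 : ℝ) / 2) : ℝ) : ℂ) *
      ∫ ξ : E3, Complex.exp (Complex.I * ((∑ α, x α * ξ α : ℝ) : ℂ)) * _root_.FT f ξ := by
  obtain ⟨F, rfl⟩ := hf
  have h1 : F x = 𝓕⁻ (𝓕 (schwartzToEuclidean F)) (WithLp.toLp 2 x) := by
    rw [FourierTransform.fourierInv_fourier_eq]; rfl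
  rw [h1, fourierInv_coe, Real.fourierInv_eq', integral_euclidean]
  have h2 := Measure.integral_comp_inv_smul_of_nonneg (volume : Measure E3) (fun ξ =>
    Complex.exp ((↑(2 * π * inner ℝ (WithLp.toLp 2 ξ) (WithLp.toLp 2 x)) * Complex.I)) •
      𝓕 (schwartzToEuclidean F) (WithLp.toLp 2 ξ)) (R := 2 * π) (by positivity)
  have h3 : Module.finrank ℝ E3 = 3 := by simp
  rw [h3, ← inv_smul_eq_iff₀ (by positivity)] at h2
  rw [← h2]
  simp_rw [FT_eq_fourier_s15]
  rw [← two_pi_rpow_mul_self, Complex.real_smul, Complex.ofReal_mul, mul_assoc]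
  congr 1
  rw [← integral_const_mul]
  congr 1 with ξ
  rw [smul_eq_mul, mul_left_comm, mul_comm Complex.I]
  congr 3
  simp only [PiLp.inner_apply, smul_eq_mul, Fin.sum_univ_three,
    RCLike.inner_apply, conj_trivial, Pi.smul_apply]
  push_cast
  have : (π : ℂ) ≠ 0 := by exact_mod_cast pi_ne_zero
  field_simp

lemma FT_lineDeriv (f : SchwartzMap E3 ℂ) (α : Fin 3) (ξ : E3) :
    FT (∂_{(Pi.single α 1 : E3)} f : SchwartzMap E3 ℂ) ξ = Complex.I * ξ α * FT f ξ := by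
  have h : schwartzToEuclidean (∂_{(Pi.single α 1 : E3)} f) =
      ∂_{(EuclideanSpace.single α 1 : EuclideanSpace ℝ (Fin 3))} (schwartzToEuclidean f) := by
    rw [schwartzToEuclidean, schwartzToEuclidean, lineDerivOp_compCLMOfContinuousLinearEquiv]
    rfl
  have ht : (fun v : EuclideanSpace ℝ (Fin 3) =>
      inner ℝ v (EuclideanSpace.single α (1 : ℝ))).HasTemperateGrowth := by fun_prop
  rw [FT_eq_fourier_s15, FT_eq_fourier_s15, h, fourier_lineDerivOp_eq, smul_apply,
    smulLeftCLM_apply_apply ht]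
  simp only [smul_eq_mul, Complex.real_smul, EuclideanSpace.inner_single_right, PiLp.smul_apply]
  have : (π : ℂ) ≠ 0 := by exact_mod_cast pi_ne_zero
  push_cast
  simp
  field_simp

lemma exists_pd_eq (f : SchwartzMap E3 ℝ) (α : Fin 3) :
    ∃ g : SchwartzMap E3 ℝ, (pd α (fun z => f z) = fun y => g y) ∧
      ∀ ξ, FT (fun y => (g y : ℂ)) ξ = Complex.I * ξ α * FT (fun y => (f y : ℂ)) ξ := by
  refine ⟨∂_{(Pi.single α 1 : E3)} f, ?_, fun ξ => ?_⟩
  · ext x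
    rw [lineDerivOp_apply_eq_fderiv]
    rfl
  · refine Eq.trans ?_ (FT_lineDeriv (postcompCLM Complex.ofRealCLM f) α ξ)
    congr 1
    ext x
    rw [lineDerivOp_apply_eq_fderiv, lineDerivOp_apply_eq_fderiv]
    have : HasFDerivAt (fun y => ((f y : ℝ) : ℂ)) (Complex.ofRealCLM ∘L fderiv ℝ f x) x :=
      Complex.ofRealCLM.hasFDerivAt.comp x f.differentiableAt.hasFDerivAt
    exact (congrArg (fun L => L (Pi.single α 1 : E3)) this.fderiv).symm

lemma integral_mul_inverseFT {f G : E3 → ℂ} (hf : Integrable f) (hG : Integrable G) :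
    ∫ x, f x * ((((2 * π) ^ (-(3 : ℝ) / 2) : ℝ) : ℂ) *
      ∫ ξ : E3, Complex.exp (Complex.I * ((∑ α, x α * ξ α : ℝ) : ℂ)) * G ξ) =
    ∫ ξ, FT f (-ξ) * G ξ := by
  set c : ℂ := (((2 * π) ^ (-(3 : ℝ) / 2) : ℝ) : ℂ) with hc
  have hint : Integrable (Function.uncurry fun x ξ : E3 =>
      c * (Complex.exp (Complex.I * ((∑ α, x α * ξ α : ℝ) : ℂ)) * (f x * G ξ)))
      (volume.prod volume) := by
    refine ((hf.mul_prod hG).bdd_mul (c := 1) ?_ (.of_forall fun p => ?_)).const_mul c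
    · exact Continuous.aestronglyMeasurable (by fun_prop)
    · rw [mul_comm, Complex.norm_exp_ofReal_mul_I]
  calc _ = ∫ x, ∫ ξ : E3,
        c * (Complex.exp (Complex.I * ((∑ α, x α * ξ α : ℝ) : ℂ)) * (f x * G ξ)) := by
        congr 1 with x
        rw [← integral_const_mul, ← integral_const_mul]
        congr 1 with ξ
        ring
    _ = ∫ ξ : E3, ∫ x,
        c * (Complex.exp (Complex.I * ((∑ α, x α * ξ α : ℝ) : ℂ)) * (f x * G ξ)) :=
        integral_integral_swap hint
    _ = _ := by
        congr 1 with ξ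
        rw [FT, ← hc, ← integral_const_mul, ← integral_mul_const]
        congr 1 with x
        simp only [Pi.neg_apply, mul_neg, Finset.sum_neg_distrib, Complex.ofReal_neg, neg_mul,
          neg_neg]
        ring

lemma FT_mul {f g : E3 → ℂ} (hf : IsSchwartz f) (hg : IsSchwartz g) (η : E3) :
    FT (fun x => g x * f x) η = (((2 * π) ^ (-(3 : ℝ) / 2) : ℝ) : ℂ) *
      ∫ ξ, FT f ξ * FT g (η - ξ) := by
  have hint : Integrable (fun x : E3 =>
      Complex.exp (-Complex.I * ((∑ α, x α * η α : ℝ) : ℂ)) * g x) := by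
    refine hg.integrable.bdd_mul (c := 1) ?_ (.of_forall fun x => ?_)
    · exact Continuous.aestronglyMeasurable (by fun_prop)
    · rw [neg_mul, ← mul_neg, mul_comm, ← Complex.ofReal_neg, Complex.norm_exp_ofReal_mul_I]
  have h := integral_mul_inverseFT hint hf.FT.integrable
  simp_rw [← hf.inversion] at h
  rw [FT]
  simp_rw [← mul_assoc]
  rw [h]
  congr 2 with ξ
  rw [mul_comm, FT, FT]
  congr 3 with x
  rw [← mul_assoc, ← Complex.exp_add]
  congr 2
  simp only [Fin.sum_univ_three, Pi.neg_apply, Pi.sub_apply]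
  push_cast
  ring

/-- The Fourier multiplier with symbol `m`, on complex functions. -/
def cmultiplier (m : E3 → ℝ) (f : E3 → ℂ) (x : E3) : ℂ :=
  (((2 * π) ^ (-(3 : ℝ) / 2) : ℝ) : ℂ) *
    ∫ ξ : E3, Complex.exp (Complex.I * ((∑ α, x α * ξ α : ℝ) : ℂ)) * ((m ξ : ℝ) : ℂ) * FT f ξ

lemma FMul_eq_cmultiplier (m f : E3 → ℝ) :
    FMul m f = cmultiplier m (fun y => (f y : ℂ)) := rfl

lemma cmultiplier_eq_FT (m : E3 → ℝ) (f : E3 → ℂ) (x : E3) :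
    cmultiplier m f x = FT (fun ξ => (m ξ : ℂ) * FT f ξ) (-x) := by
  rw [cmultiplier, FT]
  congr 2 with ξ
  rw [mul_assoc]
  congr 2
  simp only [Fin.sum_univ_three, Pi.neg_apply]
  push_cast
  ring

section Multiplier

variable {m : E3 → ℝ} {f g w : E3 → ℂ}

lemma IsSchwartz.cmultiplier (hm : (fun ξ => (m ξ : ℂ)).HasTemperateGrowth) (hf : IsSchwartz f) :
    IsSchwartz (cmultiplier m f) := by
  have : _root_.cmultiplier m f = fun x => _root_.FT (fun ξ => (m ξ : ℂ) * _root_.FT f ξ) (-x) :=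
    funext (cmultiplier_eq_FT m f)
  rw [this]
  exact (hf.FT.temperate_mul hm).FT.comp_neg

lemma integral_mul_cmultiplier (hm : (fun ξ => (m ξ : ℂ)).HasTemperateGrowth)
    (hf : IsSchwartz f) (hg : IsSchwartz g) :
    ∫ x, f x * cmultiplier m g x = ∫ ξ, FT f (-ξ) * ((m ξ : ℂ) * FT g ξ) := by
  rw [← integral_mul_inverseFT hf.integrable (hg.FT.temperate_mul hm).integrable]
  simp only [cmultiplier, mul_assoc]

/-- The kernel `f̂(ξ) ŵ(η - ξ) ĝ(-η)`, weighted by a bounded continuous factor, is integrable. -/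
lemma integrable_FT_kernel {u : E3 × E3 → ℂ} (hu : Continuous u) {C : ℝ} (hC : ∀ p, ‖u p‖ ≤ C)
    (hf : IsSchwartz f) (hg : IsSchwartz g) (hw : IsSchwartz w) :
    Integrable (fun p : E3 × E3 => u p * FT w (p.2 - p.1) * (FT f p.1 * FT g (-p.2)))
      (volume.prod volume) := by
  obtain ⟨D, hD⟩ := hw.FT.exists_norm_le
  refine (hf.FT.integrable.mul_prod hg.FT.comp_neg.integrable).bdd_mul (c := C * D) ?_
    (.of_forall fun p => ?_)
  · have := hw.FT.continuous
    exact Continuous.aestronglyMeasurable (by fun_prop)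
  · rw [norm_mul]
    exact mul_le_mul (hC p) (hD _) (norm_nonneg _) ((norm_nonneg _).trans (hC p))

lemma integral_mul_commutator (hm : (fun ξ => (m ξ : ℂ)).HasTemperateGrowth) {C : ℝ}
    (hC : ∀ ξ, ‖(m ξ : ℂ)‖ ≤ C) (heven : ∀ ξ, m (-ξ) = m ξ)
    (hf : IsSchwartz f) (hg : IsSchwartz g) (hw : IsSchwartz w) :
    ∫ x, f x * (w x * cmultiplier m g x - cmultiplier m (fun y => w y * g y) x) =
      (((2 * π) ^ (-(3 : ℝ) / 2) : ℝ) : ℂ) * ∫ p : E3 × E3,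
        ((m p.2 : ℂ) - m p.1) * FT w (p.2 - p.1) * (FT f p.1 * FT g (-p.2)) := by
  set c : ℂ := (((2 * π) ^ (-(3 : ℝ) / 2) : ℝ) : ℂ) with hc
  have hmc : Continuous (fun ξ => (m ξ : ℂ)) := hm.1.continuous
  have h1 := integrable_FT_kernel (u := fun p => (m p.2 : ℂ)) (hmc.comp continuous_snd) (fun p => hC p.2)
    hf hg hw
  have h2 := integrable_FT_kernel (u := fun p => (m p.1 : ℂ)) (hmc.comp continuous_fst) (fun p => hC p.1)
    hf hg hw
  have e1 : ∫ x, w x * f x * cmultiplier m g x = c * ∫ p : E3 × E3,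
      (m p.2 : ℂ) * FT w (p.2 - p.1) * (FT f p.1 * FT g (-p.2)) := by
    rw [integral_mul_cmultiplier hm (hw.mul hf) hg, Measure.volume_eq_prod,
      integral_prod_symm _ h1, ← integral_const_mul, ← integral_neg_eq_self]
    congr 1 with η
    rw [neg_neg, heven, FT_mul hf hw, ← hc, mul_assoc, ← integral_mul_const]
    congr 2 with ξ
    ring
  have e2 : ∫ x, f x * cmultiplier m (fun y => w y * g y) x = c * ∫ p : E3 × E3,
      (m p.1 : ℂ) * FT w (p.2 - p.1) * (FT f p.1 * FT g (-p.2)) := by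
    rw [integral_mul_cmultiplier hm hf (hw.mul hg), Measure.volume_eq_prod,
      integral_prod _ h2, ← integral_const_mul, ← integral_neg_eq_self]
    congr 1 with ξ
    rw [neg_neg, heven, FT_mul hg hw, ← hc, mul_left_comm, ← mul_assoc, mul_left_comm,
      ← integral_const_mul, ← integral_neg_eq_self]
    congr 2 with η
    rw [show -ξ - -η = η - ξ by abel]
    ring
  have i1 := ((hw.mul hf).mul (hg.cmultiplier hm)).integrable
  have i2 := (hf.mul ((hw.mul hg).cmultiplier hm)).integrable
  calc _ = ∫ x, (w x * f x * cmultiplier m g x - f x * cmultiplier m (fun y => w y * g y) x) := by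
        congr 1 with x
        ring
    _ = _ := by
        rw [integral_sub i1 i2, e1, e2, ← mul_sub, Measure.volume_eq_prod, ← integral_sub h1 h2]
        congr 2 with p
        ring

end Multiplier

instance : (volume : Measure (E3 × E3)).IsNegInvariant where
  neg_eq_self := by
    have h := Measure.map_prod_map (volume : Measure E3) (volume : Measure E3)
      measurable_neg measurable_neg
    rw [Measure.map_neg_eq_self] at h
    exact h.symm

/-- Swapping the two frequencies and reversing their signs preserves integrals. -/
lemma integral_neg_swap (K : E3 × E3 → ℂ) :
    ∫ p : E3 × E3, K (-p.2, -p.1) = ∫ p : E3 × E3, K p := by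
  have hs : ∫ p : E3 × E3, K p.swap = ∫ p : E3 × E3, K p := by
    rw [Measure.volume_eq_prod]
    exact integral_prod_swap K
  rw [← hs]
  exact integral_neg_eq_self (fun p : E3 × E3 => K p.swap) volume

lemma integrable_neg_swap {K : E3 × E3 → ℂ} (hK : Integrable K) :
    Integrable (fun p : E3 × E3 => K (-p.2, -p.1)) :=
  (Integrable.comp_neg (μ := (volume : Measure (E3 × E3))) (f := fun p => K p.swap)
    (Integrable.swap hK) :)

lemma FT_add {f g : E3 → ℂ} (hf : Integrable f) (hg : Integrable g) (ξ : E3) :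
    FT (fun x => f x + g x) ξ = FT f ξ + FT g ξ := by
  have h (x : E3) : ‖Complex.exp (-Complex.I * ((∑ α, x α * ξ α : ℝ) : ℂ))‖ ≤ 1 := by
    rw [neg_mul, ← mul_neg, mul_comm, ← Complex.ofReal_neg, Complex.norm_exp_ofReal_mul_I]
  have hc : AEStronglyMeasurable
      (fun x : E3 => Complex.exp (-Complex.I * ((∑ α, x α * ξ α : ℝ) : ℂ))) volume :=
    Continuous.aestronglyMeasurable (by fun_prop)
  simp only [FT, mul_add]
  rw [integral_add (hf.bdd_mul hc (.of_forall h)) (hg.bdd_mul hc (.of_forall h)), mul_add]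

lemma FT_const_mul (c : ℂ) (f : E3 → ℂ) (ξ : E3) :
    FT (fun x => c * f x) ξ = c * FT f ξ := by
  simp only [FT, mul_left_comm _ c, integral_const_mul]

lemma hasTemperateGrowth_ofReal_symbol {m : E3 → ℝ} (hmsm : ContDiff ℝ (⊤ : ℕ∞) m)
    (hmbdd : ∀ k : ℕ, ∃ C : ℝ, ∀ ξ, ‖iteratedFDeriv ℝ k m ξ‖ ≤ C) :
    (fun ξ => (m ξ : ℂ)).HasTemperateGrowth := by
  have h : m.HasTemperateGrowth := by
    refine ⟨hmsm, fun n => ?_⟩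
    obtain ⟨C, hC⟩ := hmbdd n
    exact ⟨0, C, by simpa using hC⟩
  exact Complex.ofRealCLM.hasTemperateGrowth.comp h

/-- the key Fourier identity behind Proposition `prop:main.N.term` of
Huneau–Luk: the commutator of multiplication by `w` with an even Fourier multiplier,
tested against `(∂_t − β^k∂_k)φ`, equals an explicit symmetrized double Fourier integral. -/
theorem stmt15
    (φ w : SchwartzMap E3 ℝ) (β1 β2 : ℝ)
    (m : E3 → ℝ) (hmsm : ContDiff ℝ (⊤ : ℕ∞) m)
    (hmbdd : ∀ k : ℕ, ∃ C : ℝ, ∀ ξ, ‖iteratedFDeriv ℝ k m ξ‖ ≤ C)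
    (hmeven : ∀ ξ, m (-ξ) = m ξ) :
    (∫ x : E3,
      ((pd 0 (fun z => φ z) x - (β1 * pd 1 (fun z => φ z) x + β2 * pd 2 (fun z => φ z) x)
          : ℝ) : ℂ) *
        ∑ i : Fin 2,
          (((w x : ℝ) : ℂ) * FMul m (fun y => pd (sp i) (pd (sp i) (fun z => φ z)) y) x
            - FMul m (fun y => w y * pd (sp i) (pd (sp i) (fun z => φ z)) y) x))
    = -(Complex.I / 2) * (((2 * Real.pi) ^ (-(3 : ℝ) / 2) : ℝ) : ℂ) *
      ∫ ξ : E3, ∫ η : E3,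
        (((ξ 0 - (β1 * ξ 1 + β2 * ξ 2)) * ((η 1) ^ 2 + (η 2) ^ 2)
            + (η 0 - (β1 * η 1 + β2 * η 2)) * ((ξ 1) ^ 2 + (ξ 2) ^ 2) : ℝ) : ℂ)
          * FT (fun y => ((φ y : ℝ) : ℂ)) ξ
          * FT (fun y => ((w y : ℝ) : ℂ)) (η - ξ)
          * FT (fun y => ((φ y : ℝ) : ℂ)) (-η)
          * (((m η - m ξ : ℝ)) : ℂ) := by
  have hm := hasTemperateGrowth_ofReal_symbol hmsm hmbdd
  obtain ⟨C, hC⟩ : ∃ C, ∀ ξ, ‖(m ξ : ℂ)‖ ≤ C := by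
    obtain ⟨C, hC⟩ := hmbdd 0
    exact ⟨C, by simpa using hC⟩
  have hmc : Continuous (fun ξ => (m ξ : ℂ)) := hm.1.continuous
  obtain ⟨g0, hg0, F0⟩ := exists_pd_eq φ 0
  obtain ⟨g1, hg1, F1⟩ := exists_pd_eq φ 1
  obtain ⟨g2, hg2, F2⟩ := exists_pd_eq φ 2
  obtain ⟨h1, hh1, H1⟩ := exists_pd_eq g1 1
  obtain ⟨h2, hh2, H2⟩ := exists_pd_eq g2 2
  have hφ := isSchwartz_ofReal φ
  have hw := isSchwartz_ofReal w
  set f : E3 → ℂ := fun x => (g0 x : ℂ) + ((-β1 : ℂ) * g1 x + (-β2 : ℂ) * g2 x) with hf_def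
  have s1 := (isSchwartz_ofReal g1).const_mul (-β1 : ℂ)
  have s2 := (isSchwartz_ofReal g2).const_mul (-β2 : ℂ)
  have hf : IsSchwartz f := (isSchwartz_ofReal g0).add (s1.add s2)
  have hFf (ξ : E3) : FT f ξ = Complex.I * ((ξ 0 - (β1 * ξ 1 + β2 * ξ 2) : ℝ) : ℂ) *
      FT (fun y => (φ y : ℂ)) ξ := by
    rw [hf_def, FT_add (isSchwartz_ofReal g0).integrable (s1.add s2).integrable,
      FT_add s1.integrable s2.integrable, FT_const_mul, FT_const_mul, F0, F1, F2]
    push_cast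
    ring
  have hFh1 (η : E3) : FT (fun y => (h1 y : ℂ)) (-η) =
      -(η 1 : ℂ) ^ 2 * FT (fun y => (φ y : ℂ)) (-η) := by
    rw [H1, F1]
    simp only [Pi.neg_apply, Complex.ofReal_neg]
    linear_combination (η 1 : ℂ) ^ 2 * FT (fun y => (φ y : ℂ)) (-η) * Complex.I_mul_I
  have hFh2 (η : E3) : FT (fun y => (h2 y : ℂ)) (-η) =
      -(η 2 : ℂ) ^ 2 * FT (fun y => (φ y : ℂ)) (-η) := by
    rw [H2, F2]
    simp only [Pi.neg_apply, Complex.ofReal_neg]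
    linear_combination (η 2 : ℂ) ^ 2 * FT (fun y => (φ y : ℂ)) (-η) * Complex.I_mul_I
  have kernel_int {g : E3 → ℂ} (hg : IsSchwartz g) := integrable_FT_kernel
    (u := fun p => (m p.2 : ℂ) - m p.1) (C := C + C)
    ((hmc.comp continuous_snd).sub (hmc.comp continuous_fst))
    (fun p => (norm_sub_le _ _).trans (add_le_add (hC _) (hC _))) hf hg hw
  have k1 := kernel_int (isSchwartz_ofReal h1)
  have k2 := kernel_int (isSchwartz_ofReal h2)
  set c : ℂ := (((2 * π) ^ (-(3 : ℝ) / 2) : ℝ) : ℂ) with hc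
  set J : E3 × E3 → ℂ := fun p =>
    (((p.1 0 - (β1 * p.1 1 + β2 * p.1 2)) * ((p.2 1) ^ 2 + (p.2 2) ^ 2) : ℝ) : ℂ)
      * FT (fun y => ((φ y : ℝ) : ℂ)) p.1
      * FT (fun y => ((w y : ℝ) : ℂ)) (p.2 - p.1)
      * FT (fun y => ((φ y : ℝ) : ℂ)) (-p.2)
      * ((m p.2 - m p.1 : ℝ) : ℂ) with hJ_def
  have hJ_eq (p : E3 × E3) :
      ((m p.2 : ℂ) - m p.1) * FT (fun y => (w y : ℂ)) (p.2 - p.1) *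
          (FT f p.1 * FT (fun y => (h1 y : ℂ)) (-p.2)) +
        ((m p.2 : ℂ) - m p.1) * FT (fun y => (w y : ℂ)) (p.2 - p.1) *
          (FT f p.1 * FT (fun y => (h2 y : ℂ)) (-p.2)) = -Complex.I * J p := by
    rw [hFf, hFh1, hFh2]
    simp only [hJ_def]
    push_cast
    ring
  have hJ : Integrable J := by
    have := ((k1.add k2).congr (.of_forall hJ_eq)).const_mul Complex.I
    refine this.congr (.of_forall fun p => ?_)
    linear_combination -J p * Complex.I_mul_I
  have hJ' := integrable_neg_swap hJ
  have hN (ξ η : E3) : (((ξ 0 - (β1 * ξ 1 + β2 * ξ 2)) * ((η 1) ^ 2 + (η 2) ^ 2)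
            + (η 0 - (β1 * η 1 + β2 * η 2)) * ((ξ 1) ^ 2 + (ξ 2) ^ 2) : ℝ) : ℂ)
          * FT (fun y => ((φ y : ℝ) : ℂ)) ξ
          * FT (fun y => ((w y : ℝ) : ℂ)) (η - ξ)
          * FT (fun y => ((φ y : ℝ) : ℂ)) (-η)
          * (((m η - m ξ : ℝ)) : ℂ) = J (ξ, η) + J (-η, -ξ) := by
    simp only [hJ_def, hmeven, neg_neg, Pi.neg_apply]
    rw [show -ξ - -η = η - ξ by abel]
    push_cast
    ring
  have hR : ∫ ξ : E3, ∫ η : E3, (J (ξ, η) + J (-η, -ξ)) = 2 * ∫ p, J p := by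
    rw [integral_integral (f := fun ξ η => J (ξ, η) + J (-η, -ξ)) (hJ.add hJ'),
      ← Measure.volume_eq_prod]
    exact (integral_add hJ hJ').trans (by rw [integral_neg_swap]; ring)
  have hi {g : E3 → ℂ} (hg : IsSchwartz g) : Integrable fun x => f x *
      ((w x : ℂ) * cmultiplier m g x - cmultiplier m (fun y => (w y : ℂ) * g y) x) :=
    (hf.mul ((hw.mul (hg.cmultiplier hm)).sub ((hw.mul hg).cmultiplier hm))).integrable
  simp_rw [hN]
  rw [hR]
  calc _ = ∫ x, (f x * ((w x : ℂ) * cmultiplier m (fun y => (h1 y : ℂ)) x -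
            cmultiplier m (fun y => (w y : ℂ) * h1 y) x) +
          f x * ((w x : ℂ) * cmultiplier m (fun y => (h2 y : ℂ)) x -
            cmultiplier m (fun y => (w y : ℂ) * h2 y) x)) := by
        congr 1 with x
        simp only [Fin.sum_univ_two, sp, Matrix.cons_val_zero, Matrix.cons_val_one, hg0, hg1, hg2,
          hh1, hh2, FMul_eq_cmultiplier, hf_def]
        push_cast
        ring
    _ = c * ∫ p, -Complex.I * J p := by
        rw [integral_add (hi (isSchwartz_ofReal h1)) (hi (isSchwartz_ofReal h2)),
          integral_mul_commutator hm hC hmeven hf (isSchwartz_ofReal h1) hw,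
          integral_mul_commutator hm hC hmeven hf (isSchwartz_ofReal h2) hw, ← hc, ← mul_add,
          Measure.volume_eq_prod, ← integral_add k1 k2]
        simp_rw [hJ_eq]
    _ = _ := by
        rw [integral_const_mul]
        ring

end
end
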